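/- arXiv:1803.09235 — 12 statements merged into one kernel-verified Lean document; each statement's English description precedes it below -/
import Mathlib

section
/- Let n > 1 be an integer, let x ∈ [0,1], let r be a non-negative integer with r ≤ nx - √n, and let c be a real number with -min{x,1-x}/(n-1) ≤ c ≤ 0. Then x^{(r+1,c)} · (1-x)^{(n-r,c)} / 1^{(n,c)} ≤ x^{r+1} · (1-x)^{n-r}. -/
open scoped BigOperators

/-- The generalized rising factorial `x^{(n,h)} = x(x+h)···(x+(n-1)h)`. -/
noncomputable def risingFac (x h : ℝ) (n : ℕ) : ℝ := ∏ i ∈ Finset.range n, (x + i * h)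

/-- The function `u log u - u + 1`, an antiderivative of `log`. -/
noncomputable def logPrimitive (u : ℝ) : ℝ := u * Real.log u - u + 1

theorem logPrimitive_tangent_le {u w : ℝ} (hu : 0 < u) (hw : 0 < w) :
    logPrimitive w + Real.log w * (u - w) ≤ logPrimitive u := by
  have h := Real.log_le_sub_one_of_pos (div_pos hw hu)
  rw [Real.log_div hw.ne' hu.ne'] at h
  have h' := mul_le_mul_of_nonneg_left h hu.le
  have e : u * (w / u - 1) = w - u := by field_simp
  unfold logPrimitive
  linarith

theorem logPrimitive_nonneg {u : ℝ} (hu : 0 < u) : 0 ≤ logPrimitive u := by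
  simpa [logPrimitive] using logPrimitive_tangent_le hu one_pos

theorem two_mul_sub_one_le_add_one_mul_log {z : ℝ} (hz : 1 ≤ z) :
    2 * (z - 1) ≤ (z + 1) * Real.log z := by
  have h := Real.le_log_one_add_of_nonneg (sub_nonneg.2 hz)
  rw [div_le_iff₀ (by linarith), add_sub_cancel] at h
  linarith

/-- Trapezoid bound for the convex function `-log`. -/
theorem logPrimitive_sub_le_trapezoid {u v : ℝ} (hv : 0 < v) (huv : v ≤ u) :
    logPrimitive v - logPrimitive u ≤ (u - v) * (-Real.log u - Real.log v) / 2 := by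
  have hu := hv.trans_le huv
  have h := two_mul_sub_one_le_add_one_mul_log ((one_le_div hv).2 huv)
  rw [Real.log_div hu.ne' hv.ne'] at h
  have h' := mul_le_mul_of_nonneg_left h hv.le
  have e₁ : v * (2 * (u / v - 1)) = 2 * (u - v) := by field_simp
  have e₂ : v * ((u / v + 1) * (Real.log u - Real.log v)) =
      (u + v) * (Real.log u - Real.log v) := by field_simp
  rw [e₁, e₂] at h'
  unfold logPrimitive
  linarith

theorem one_add_mul_log_sub_one_sub_mul_log_le {q : ℝ} (hq : 0 ≤ q) (hq1 : q < 1) :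
    (1 + q) * Real.log (1 + q) - (1 - q) * Real.log (1 - q) ≤ 2 * q := by
  have hd : ∀ t : ℝ, 0 ≤ t → t < 1 → HasDerivAt
      (fun t => 2 * t - ((1 + t) * Real.log (1 + t) - (1 - t) * Real.log (1 - t)))
      (2 * 1 - ((Real.log (1 + t) + 1) * 1 - (Real.log (1 - t) + 1) * (-1))) t := by
    intro t h0 h1
    have hp := (Real.hasDerivAt_mul_log (x := 1 + t) (by linarith)).comp t
      ((hasDerivAt_id t).const_add 1)
    have hm := (Real.hasDerivAt_mul_log (x := 1 - t) (by linarith)).comp t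
      ((hasDerivAt_id t).const_sub 1)
    exact ((hasDerivAt_id t).const_mul 2).sub (hp.sub hm)
  have hmono : MonotoneOn
      (fun t => 2 * t - ((1 + t) * Real.log (1 + t) - (1 - t) * Real.log (1 - t)))
      (Set.Ico (0 : ℝ) 1) := by
    refine monotoneOn_of_deriv_nonneg (convex_Ico 0 1) ?_ ?_ ?_
    · intro t ht
      exact (hd t ht.1 ht.2).continuousAt.continuousWithinAt
    · intro t ht
      rw [interior_Ico] at ht
      exact (hd t ht.1.le ht.2).differentiableAt.differentiableWithinAt
    · intro t ht
      rw [interior_Ico] at ht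
      rw [(hd t ht.1.le ht.2).deriv]
      have hp := Real.log_le_sub_one_of_pos (show 0 < 1 + t by linarith [ht.1])
      have hm := Real.log_le_sub_one_of_pos (show 0 < 1 - t by linarith [ht.2])
      linarith
  have h := hmono (Set.mem_Ico.2 ⟨le_rfl, one_pos⟩) (Set.mem_Ico.2 ⟨hq, hq1⟩) hq
  norm_num at h
  linarith

/-- Midpoint bound for the convex function `-log`. -/
theorem midpoint_le_logPrimitive_sub {u h : ℝ} (hh : 0 ≤ h) (hu : h < u) :
    2 * h * -Real.log u ≤ logPrimitive (u - h) - logPrimitive (u + h) := by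
  have hu0 := hh.trans_lt hu
  have hq := one_add_mul_log_sub_one_sub_mul_log_le (div_nonneg hh hu0.le)
    ((div_lt_one hu0).2 hu)
  have e₁ : 1 + h / u = (u + h) / u := by field_simp
  have e₂ : 1 - h / u = (u - h) / u := by field_simp
  rw [e₁, e₂, Real.log_div (by linarith) hu0.ne', Real.log_div (by linarith) hu0.ne'] at hq
  have h' := mul_le_mul_of_nonneg_left hq hu0.le
  have e₃ : u * ((u + h) / u * (Real.log (u + h) - Real.log u) -
      (u - h) / u * (Real.log (u - h) - Real.log u)) =
      (u + h) * (Real.log (u + h) - Real.log u) -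
      (u - h) * (Real.log (u - h) - Real.log u) := by field_simp
  have e₄ : u * (2 * (h / u)) = 2 * h := by field_simp
  rw [e₃, e₄] at h'
  unfold logPrimitive
  linarith

theorem logPrimitive_le_mul_sum_neg_log {e : ℝ} (he : 0 ≤ e) (r : ℕ) (hr : r * e < 1) :
    logPrimitive (1 - r * e) - e * Real.log (1 - r * e) / 2 ≤
      e * ∑ i ∈ Finset.range (r + 1), -Real.log (1 - i * e) := by
  induction r with
  | zero => simp [logPrimitive]
  | succ r ih =>
    push_cast at hr ⊢
    have ih' := ih (by linarith)
    have ht := logPrimitive_sub_le_trapezoid (u := 1 - r * e) (v := 1 - (r + 1) * e)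
      (by linarith) (by linarith)
    have hs : 1 - r * e - (1 - (r + 1) * e) = e := by ring
    rw [hs] at ht
    rw [Finset.sum_range_succ, mul_add]
    push_cast
    linarith

theorem mul_sum_neg_log_le_logPrimitive {d : ℝ} (hd : 0 ≤ d) (n : ℕ)
    (hn : (n - 1 / 2) * d < 1) :
    d * ∑ k ∈ Finset.range n, -Real.log (1 - k * d) ≤
      logPrimitive (1 - (n - 1 / 2) * d) - logPrimitive (1 + d / 2) := by
  induction n with
  | zero =>
    have e : 1 - (((0 : ℕ) : ℝ) - 1 / 2) * d = 1 + d / 2 := by push_cast; ring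
    simp only [e, Finset.range_zero, Finset.sum_empty, mul_zero, sub_self, le_refl]
  | succ n ih =>
    push_cast at hn ⊢
    have ih' := ih (by linarith)
    have hm := midpoint_le_logPrimitive_sub (u := 1 - n * d) (h := d / 2)
      (by linarith) (by linarith)
    have e₁ : 1 - n * d - d / 2 = 1 - ((n : ℝ) + 1 - 1 / 2) * d := by ring
    have e₂ : 1 - n * d + d / 2 = 1 - ((n : ℝ) - 1 / 2) * d := by ring
    rw [e₁, e₂] at hm
    rw [Finset.sum_range_succ, mul_add]
    linarith

/-- The logarithmic form of the inequality, with `n = r + m + 1`. -/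
theorem sum_neg_log_le_sum_neg_log_add {x y d : ℝ} (hx : 0 < x) (hy : 0 < y) (hxy : x + y = 1)
    (hd : 0 < d) (r m : ℕ) (hr : r * d < x) (hm : m * d < y)
    (hmy : (r + m + 1) * y ≤ m) :
    ∑ k ∈ Finset.range (r + m + 1), -Real.log (1 - k * d) ≤
      ∑ i ∈ Finset.range (r + 1), -Real.log (1 - i * (d / x)) +
      ∑ j ∈ Finset.range (m + 1), -Real.log (1 - j * (d / y)) := by
  have hA : r * (d / x) < 1 := by rw [← mul_div_assoc]; exact (div_lt_one hx).2 hr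
  have hB : m * (d / y) < 1 := by rw [← mul_div_assoc]; exact (div_lt_one hy).2 hm
  have hBW : ((r : ℝ) + m + 1 - 1 / 2) * d ≤ m * (d / y) := by
    have h := mul_le_mul_of_nonneg_right hmy (div_pos hd hy).le
    have e : ((r : ℝ) + m + 1) * y * (d / y) = (r + m + 1) * d := by field_simp
    linarith
  have h₁ := mul_le_mul_of_nonneg_left
    (logPrimitive_le_mul_sum_neg_log (div_pos hd hx).le r hA) hx.le
  have h₂ := mul_le_mul_of_nonneg_left
    (logPrimitive_le_mul_sum_neg_log (div_pos hd hy).le m hB) hy.le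
  have h₃ := mul_sum_neg_log_le_logPrimitive hd.le (r + m + 1) (by push_cast; linarith)
  push_cast at h₃
  have h₀ := logPrimitive_nonneg (u := 1 + d / 2) (by linarith)
  rw [← mul_assoc, mul_div_cancel₀ _ hx.ne'] at h₁
  rw [← mul_assoc, mul_div_cancel₀ _ hy.ne'] at h₂
  set A := 1 - r * (d / x) with hAdef
  set B := 1 - m * (d / y) with hBdef
  set W := 1 - ((r : ℝ) + m + 1 - 1 / 2) * d with hWdef
  have hApos : 0 < A := by linarith
  have hBpos : 0 < B := by linarith
  have hWpos : 0 < W := by linarith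
  have t₁ := mul_le_mul_of_nonneg_left (logPrimitive_tangent_le hApos hWpos) hx.le
  have t₂ := mul_le_mul_of_nonneg_left (logPrimitive_tangent_le hBpos hWpos) hy.le
  have hlogA : d * Real.log A ≤ 0 := mul_nonpos_of_nonneg_of_nonpos hd.le
    (Real.log_nonpos hApos.le (by
      have : 0 ≤ r * (d / x) := by positivity
      linarith))
  have hlogB : d * Real.log B ≤ d * Real.log W :=
    mul_le_mul_of_nonneg_left (Real.log_le_log hBpos (by linarith)) hd.le
  have hxA : x * A = x - r * d := by rw [hAdef]; field_simp
  have hyB : y * B = y - m * d := by rw [hBdef]; field_simp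
  have e₁ : x * (d / x * Real.log A / 2) = d * Real.log A / 2 := by field_simp
  have e₂ : y * (d / y * Real.log B / 2) = d * Real.log B / 2 := by field_simp
  have key : x * (logPrimitive W + Real.log W * (A - W)) +
      y * (logPrimitive W + Real.log W * (B - W)) =
      logPrimitive W + d * Real.log W / 2 := by
    have : x * A + y * B - W = d / 2 := by rw [hxA, hyB, hWdef]; linear_combination hxy
    linear_combination (logPrimitive W - W * Real.log W) * hxy + Real.log W * this
  refine le_of_mul_le_mul_left ?_ hd
  rw [mul_add]
  linarith

theorem risingFac_neg_eq {x : ℝ} (hx : x ≠ 0) (d : ℝ) (n : ℕ) :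
    risingFac x (-d) n = x ^ n * ∏ i ∈ Finset.range n, (1 - i * (d / x)) := by
  rw [risingFac, ← Finset.card_range n, ← Finset.prod_const, Finset.card_range,
    ← Finset.prod_mul_distrib]
  refine Finset.prod_congr rfl fun i _ => ?_
  field_simp
  ring

theorem one_sub_mul_pos_of_mem_range {e : ℝ} (he : 0 ≤ e) {m : ℕ} (hm : m * e < 1) {i : ℕ}
    (hi : i ∈ Finset.range (m + 1)) : 0 < 1 - i * e := by
  have him : (i : ℝ) ≤ m := by exact_mod_cast Nat.lt_succ_iff.1 (Finset.mem_range.1 hi)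
  have := mul_le_mul_of_nonneg_right him he
  linarith

theorem prod_one_sub_mul_prod_one_sub_le {x y d : ℝ} (hx : 0 < x) (hy : 0 < y)
    (hxy : x + y = 1) (hd : 0 < d) (r m : ℕ) (hr : r * d < x) (hm : m * d < y)
    (hmy : (r + m + 1) * y ≤ m) :
    (∏ i ∈ Finset.range (r + 1), (1 - i * (d / x))) *
      ∏ j ∈ Finset.range (m + 1), (1 - j * (d / y)) ≤
      ∏ k ∈ Finset.range (r + m + 1), (1 - k * d) := by
  have hA : r * (d / x) < 1 := by rw [← mul_div_assoc]; exact (div_lt_one hx).2 hr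
  have hB : m * (d / y) < 1 := by rw [← mul_div_assoc]; exact (div_lt_one hy).2 hm
  have hC : ((r + m : ℕ) : ℝ) * d < 1 := by push_cast; linarith
  have pA := fun i hi => one_sub_mul_pos_of_mem_range (div_pos hd hx).le hA (i := i) hi
  have pB := fun i hi => one_sub_mul_pos_of_mem_range (div_pos hd hy).le hB (i := i) hi
  have pC := fun i hi => one_sub_mul_pos_of_mem_range hd.le hC (i := i) hi
  have h := sum_neg_log_le_sum_neg_log_add hx hy hxy hd r m hr hm hmy
  simp only [Finset.sum_neg_distrib] at h
  rw [← Real.log_prod fun i hi => (pA i hi).ne', ← Real.log_prod fun i hi => (pB i hi).ne',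
    ← Real.log_prod fun i hi => (pC i hi).ne'] at h
  have qA := Finset.prod_pos pA
  have qB := Finset.prod_pos pB
  rw [← Real.log_le_log_iff (mul_pos qA qB) (Finset.prod_pos pC),
    Real.log_mul qA.ne' qB.ne']
  linarith

theorem rising_factorial_ineq (n : ℕ) (hn : 1 < n) (x : ℝ) (hx : x ∈ Set.Icc (0:ℝ) 1)
    (r : ℕ) (hr : (r : ℝ) ≤ n * x - Real.sqrt n)
    (c : ℝ) (hc₁ : -(min x (1 - x)) / (n - 1) ≤ c) (hc₂ : c ≤ 0) :
    risingFac x c (r + 1) * risingFac (1 - x) c (n - r) / risingFac 1 c n ≤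
      x ^ (r + 1) * (1 - x) ^ (n - r) := by
  obtain ⟨hx0, hx1⟩ := hx
  obtain rfl | hc := hc₂.eq_or_lt
  · simp [risingFac]
  obtain ⟨d, rfl⟩ : ∃ d, c = -d := ⟨-c, by ring⟩
  have hd : 0 < d := by linarith
  have hnR : (1 : ℝ) < n := by exact_mod_cast hn
  have hsqrt : 1 < Real.sqrt n := by
    rw [Real.lt_sqrt zero_le_one]
    simpa using hnR
  have hmin : (n - 1) * d ≤ min x (1 - x) := by
    rw [div_le_iff₀ (by linarith)] at hc₁
    linarith
  have hdx := hmin.trans (min_le_left _ _)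
  have hdy := hmin.trans (min_le_right _ _)
  have hpos : 0 < (n - 1) * d := mul_pos (by linarith) hd
  have hxpos : 0 < x := by linarith
  have hypos : 0 < 1 - x := by linarith
  have hnx : (n : ℝ) * x ≤ n := mul_le_of_le_one_right (by linarith) hx1
  have hrn : (r : ℝ) < n - 1 := by linarith
  obtain ⟨m, rfl⟩ : ∃ m, n = r + m + 1 := by
    have : r < n := by exact_mod_cast (by linarith : (r : ℝ) < n)
    exact ⟨n - r - 1, by omega⟩
  have hnr : r + m + 1 - r = m + 1 := by omega
  rw [hnr]
  push_cast at hr hrn hdx hdy hsqrt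
  have hrd : r * d < x := (mul_lt_mul_of_pos_right hrn hd).trans_le hdx
  have hmd : m * d ≤ 1 - x := by
    have : 0 ≤ r * d := by positivity
    linarith
  rw [risingFac_neg_eq hxpos.ne', risingFac_neg_eq hypos.ne', risingFac_neg_eq one_ne_zero]
  obtain hmd | hmd := hmd.eq_or_lt
  · have hzero : ∏ j ∈ Finset.range (m + 1), (1 - (j : ℝ) * (d / (1 - x))) = 0 := by
      refine Finset.prod_eq_zero (Finset.self_mem_range_succ m) ?_
      rw [← mul_div_assoc, hmd, div_self hypos.ne', sub_self]
    rw [hzero]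
    simp only [mul_zero, zero_div]
    positivity
  have hprod := prod_one_sub_mul_prod_one_sub_le hxpos hypos (by ring) hd r m hrd hmd
    (by linarith)
  have hden : 0 < ∏ k ∈ Finset.range (r + m + 1), (1 - (k : ℝ) * d) :=
    Finset.prod_pos fun i hi => one_sub_mul_pos_of_mem_range hd.le
      (by push_cast; linarith) hi
  simp only [one_pow, one_mul, div_one]
  rw [div_le_iff₀ hden, mul_mul_mul_comm]
  exact mul_le_mul_of_nonneg_left hprod (by positivity)
end

section
/- Let n > 1 be an integer, let x ∈ [0,1], let r be a non-negative integer with r ≤ nx - √n, and let c be a real number with -min{x,1-x}/(n-1) ≤ c < 0. Then the strict inequality x^{(r+1,c)} · (1-x)^{(n-r,c)} / 1^{(n,c)} < x^{r+1} · (1-x)^{n-r} holds. -/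
open scoped BigOperators

/-- Abel summation: monotone weights bounded below by `L`, against a sequence whose tail sums
are nonnegative. -/
lemma mul_sum_le_sum_mul_of_tails_nonneg : ∀ (N : ℕ) (w e : Fin N → ℝ) (L : ℝ), Monotone w →
    (∀ k, L ≤ w k) → (∀ K : Fin N, 0 ≤ ∑ k, if K ≤ k then e k else 0) →
    L * ∑ k, e k ≤ ∑ k, w k * e k := by
  intro N
  induction N with
  | zero => intro w e L _ _ _; simp
  | succ N ih =>
    intro w e L hw hL ht
    have htotal : 0 ≤ ∑ k, e k := by simpa using ht 0
    have htail := ih (fun k => w k.succ) (fun k => e k.succ) (w 0)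
      (fun i j hij => hw (Fin.succ_le_succ_iff.mpr hij)) (fun k => hw (Fin.zero_le _))
      (fun K => by
        have := ht K.succ
        rw [Fin.sum_univ_succ] at this
        simpa [Fin.succ_le_succ_iff] using this)
    have hhead := mul_le_mul_of_nonneg_right (hL 0) htotal
    rw [Fin.sum_univ_succ] at hhead ⊢
    rw [Fin.sum_univ_succ (fun k => w k * e k)]
    linarith

/-- A sequence `a` weakly majorizing a monotone sequence `b`, strictly in total sum, makes
`∏ (1 - d * a)` strictly smaller than `∏ (1 - d * b)`; here `a` is assumed sorted. -/
lemma prod_one_sub_lt_of_monotone {N : ℕ} (a b : Fin N → ℝ) (d : ℝ) (hd : 0 < d)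
    (ha : Monotone a) (hb : Monotone b) (ha0 : ∀ k, 0 ≤ a k) (had : ∀ k, d * a k ≤ 1)
    (hb0 : ∀ k, 0 ≤ b k) (hbd : ∀ k, d * b k < 1)
    (hmaj : ∀ t, 0 ≤ t → ∑ k, max (b k - t) 0 ≤ ∑ k, max (a k - t) 0)
    (hsum : ∑ k, b k < ∑ k, a k) :
    ∏ k, (1 - d * a k) < ∏ k, (1 - d * b k) := by
  have hpos : ∀ k, 0 < 1 - d * b k := fun k => by linarith [hbd k]
  have hprod : 0 < ∏ k, (1 - d * b k) := Finset.prod_pos fun k _ => hpos k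
  have hweighted : d * ∑ k, (a k - b k) ≤ ∑ k, d / (1 - d * b k) * (a k - b k) := by
    apply mul_sum_le_sum_mul_of_tails_nonneg
    · intro i j hij
      have := mul_le_mul_of_nonneg_left (hb hij) hd.le
      exact div_le_div_of_nonneg_left hd.le (hpos j) (by linarith)
    · intro k
      rw [le_div_iff₀ (hpos k)]
      nlinarith [mul_nonneg hd.le (hb0 k)]
    · intro K
      have hK := sub_nonneg.mpr (hmaj (a K) (ha0 K))
      rw [← Finset.sum_sub_distrib] at hK
      refine hK.trans (Finset.sum_le_sum fun k _ => ?_)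
      split_ifs with h
      · rw [max_eq_left (sub_nonneg.mpr (ha h))]
        linarith [le_max_left (b k - a K) 0]
      · rw [max_eq_right (sub_nonpos.mpr (ha (not_le.mp h).le))]
        linarith [le_max_right (b k - a K) 0]
  have hfactor : ∀ k, 1 - d * a k ≤
      (1 - d * b k) * Real.exp (-(d / (1 - d * b k) * (a k - b k))) := by
    intro k
    have h := mul_le_mul_of_nonneg_left
      (Real.add_one_le_exp (-(d / (1 - d * b k) * (a k - b k)))) (hpos k).le
    refine le_trans (le_of_eq ?_) h
    have := (hpos k).ne'
    field_simp
    ring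
  calc ∏ k, (1 - d * a k)
      ≤ ∏ k, ((1 - d * b k) * Real.exp (-(d / (1 - d * b k) * (a k - b k)))) :=
        Finset.prod_le_prod (fun k _ => by linarith [had k]) fun k _ => hfactor k
    _ = (∏ k, (1 - d * b k)) * Real.exp (-∑ k, d / (1 - d * b k) * (a k - b k)) := by
        rw [Finset.prod_mul_distrib, ← Real.exp_sum, Finset.sum_neg_distrib]
    _ < ∏ k, (1 - d * b k) := by
        apply mul_lt_of_lt_one_right hprod
        rw [Real.exp_lt_one_iff]
        rw [Finset.sum_sub_distrib] at hweighted
        have := mul_pos hd (sub_pos.mpr hsum)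
        linarith

/-- `prod_one_sub_lt_of_monotone` without the sortedness assumption on `a`. -/
lemma prod_one_sub_lt_of_majorize {N : ℕ} (a b : Fin N → ℝ) (d : ℝ) (hd : 0 < d)
    (hb : Monotone b) (ha0 : ∀ k, 0 ≤ a k) (had : ∀ k, d * a k ≤ 1)
    (hb0 : ∀ k, 0 ≤ b k) (hbd : ∀ k, d * b k < 1)
    (hmaj : ∀ t, 0 ≤ t → ∑ k, max (b k - t) 0 ≤ ∑ k, max (a k - t) 0)
    (hsum : ∑ k, b k < ∑ k, a k) :
    ∏ k, (1 - d * a k) < ∏ k, (1 - d * b k) := by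
  rw [← Equiv.prod_comp (Tuple.sort a) (fun k => 1 - d * a k)]
  refine prod_one_sub_lt_of_monotone (a ∘ Tuple.sort a) b d hd (Tuple.monotone_sort a) hb
    (fun k => ha0 _) (fun k => had _) hb0 hbd (fun t ht => ?_) ?_
  · exact (hmaj t ht).trans_eq
      (Equiv.sum_comp (Tuple.sort a) (fun k => max (a k - t) 0)).symm
  · exact hsum.trans_eq (Equiv.sum_comp (Tuple.sort a) a).symm

lemma sum_max_sub_eq_zero (N : ℕ) (u : ℝ) (hu : (N : ℝ) ≤ u) :
    ∑ i : Fin N, max ((i : ℝ) + 1 - u) 0 = 0 := by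
  refine Finset.sum_eq_zero fun i _ => max_eq_right ?_
  have : ((i : ℕ) : ℝ) + 1 ≤ N := by exact_mod_cast i.2
  linarith

lemma le_sum_max_sub (N : ℕ) (u : ℝ) (hu0 : 0 ≤ u) (hu : u ≤ N + 1) :
    ((N : ℝ) - u) * (N - u + 1) / 2 ≤ ∑ i : Fin N, max ((i : ℝ) + 1 - u) 0 := by
  induction N with
  | zero =>
    simp only [Nat.cast_zero] at hu ⊢
    simp only [Finset.univ_eq_empty, Finset.sum_empty]
    nlinarith
  | succ N ih =>
    rcases le_total u (N + 1) with h | h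
    · rw [Fin.sum_univ_castSucc]
      simp only [Fin.val_castSucc, Fin.val_last]
      rw [max_eq_left (by linarith)]
      push_cast
      linarith [ih h]
    · refine le_trans ?_ (Finset.sum_nonneg fun i _ => le_max_right _ _)
      push_cast at hu ⊢
      nlinarith

lemma sum_max_sub_le (N : ℕ) (u : ℝ) :
    ∑ i : Fin N, max ((i : ℝ) + 1 - u) 0 ≤ ((N : ℝ) - u) * (N - u + 1) / 2 + 1 / 8 := by
  induction N with
  | zero =>
    simp only [Nat.cast_zero, Finset.univ_eq_empty, Finset.sum_empty]
    nlinarith [sq_nonneg (u - 1 / 2)]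
  | succ N ih =>
    rcases le_total u (N + 1) with h | h
    · rw [Fin.sum_univ_castSucc]
      simp only [Fin.val_castSucc, Fin.val_last]
      rw [max_eq_left (by linarith)]
      push_cast
      linarith
    · rw [sum_max_sub_eq_zero (N + 1) u (by push_cast; exact h)]
      nlinarith [sq_nonneg (((N + 1 : ℕ) : ℝ) - u + 1 / 2)]

lemma sum_max_div_sub (N : ℕ) (x t : ℝ) (hx : 0 < x) :
    ∑ i : Fin N, max (((i : ℝ) + 1) / x - t) 0 =
      (∑ i : Fin N, max ((i : ℝ) + 1 - t * x) 0) / x := by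
  rw [Finset.sum_div]
  refine Finset.sum_congr rfl fun i _ => ?_
  have h : ((i : ℝ) + 1) / x - t = ((i : ℝ) + 1 - t * x) / x := by field_simp
  rw [h, ← max_div_div_right hx.le, zero_div]

/-- The points `i / x` (`1 ≤ i ≤ r`) and `j / (1 - x)` (`1 ≤ j ≤ m`) strictly dominate
`1, …, r + m` in the sense of the sums of positive parts above any level `t ≤ r + m`. -/
lemma sum_max_sub_lt (r m : ℕ) (x t : ℝ) (hx0 : 0 < x) (hx1 : x < 1)
    (hr : (r : ℝ) + 1 ≤ (r + m + 1) * x) (ht0 : 0 ≤ t) (ht : t ≤ r + m) :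
    ∑ k : Fin (r + m), max ((k : ℝ) + 1 - t) 0 <
      (∑ i : Fin r, max (((i : ℝ) + 1) / x - t) 0) +
        ∑ j : Fin m, max (((j : ℝ) + 1) / (1 - x) - t) 0 := by
  have hy : 0 < 1 - x := by linarith
  have hupper := sum_max_sub_le (r + m) t
  have hm := le_sum_max_sub m (t * (1 - x)) (by positivity) (by nlinarith)
  have hm' := div_le_div_of_nonneg_right hm hy.le
  rw [sum_max_div_sub r x t hx0, sum_max_div_sub m (1 - x) t hy]
  push_cast at hupper
  obtain ⟨s, hs⟩ : ∃ s : ℝ, s = (r + m + 1) * x - r := ⟨_, rfl⟩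
  obtain ⟨w, hw⟩ : ∃ w : ℝ, w = r + m + 1 - t := ⟨_, rfl⟩
  have hs1 : 1 ≤ s := by linarith
  have hw1 : 1 ≤ w := by linarith
  have hmw : (m : ℝ) - t * (1 - x) = w * (1 - x) + s - 1 := by rw [hs, hw]; ring
  have hrw : (r : ℝ) - t * x = w * x - s := by rw [hs, hw]; ring
  have hnw : (r : ℝ) + m - t = w - 1 := by rw [hw]; ring
  rw [hmw] at hm'
  rw [hnw] at hupper
  refine hupper.trans_lt ?_
  rcases le_total (t * x) (r + 1) with h | h
  · have hr' := div_le_div_of_nonneg_right (le_sum_max_sub r (t * x) (by positivity) h) hx0.le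
    rw [hrw] at hr'
    refine lt_of_lt_of_le ?_ (add_le_add hr' hm')
    have hid : (w * x - s) * (w * x - s + 1) / 2 / x +
        (w * (1 - x) + s - 1) * (w * (1 - x) + s - 1 + 1) / 2 / (1 - x) =
        w ^ 2 / 2 + s * (s - 1) / (2 * x * (1 - x)) := by
      have := hx0.ne'
      have := hy.ne'
      field_simp
      ring
    have hnn : 0 ≤ s * (s - 1) / (2 * x * (1 - x)) :=
      div_nonneg (mul_nonneg (by linarith) (by linarith)) (by positivity)
    rw [hid]
    nlinarith
  · have hnonneg : 0 ≤ (∑ i : Fin r, max ((i : ℝ) + 1 - t * x) 0) / x :=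
      div_nonneg (Finset.sum_nonneg fun i _ => le_max_right _ _) hx0.le
    refine lt_of_lt_of_le ?_ (hm'.trans (le_add_of_nonneg_left hnonneg))
    rw [lt_div_iff₀ hy]
    have hws : w * x ≤ s - 1 := by linarith
    have hfst : w * (1 - x) ≤ w * (1 - x) + s - 1 := by linarith
    have hsnd : w + 1 ≤ w * (1 - x) + s - 1 + 1 := by linarith
    have hmul := mul_le_mul hfst hsnd (by linarith) (by nlinarith)
    nlinarith

lemma risingFac_succ_eq (x c : ℝ) (hx : x ≠ 0) (N : ℕ) :
    risingFac x c (N + 1) = x ^ (N + 1) * ∏ i : Fin N, (1 - -c * (((i : ℝ) + 1) / x)) := by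
  rw [risingFac, Finset.prod_range_succ', ← Fin.prod_univ_eq_prod_range
    (fun i => x + ((i + 1 : ℕ) : ℝ) * c), pow_succ]
  have h : ∀ i : Fin N, x + ((i + 1 : ℕ) : ℝ) * c = x * (1 - -c * (((i : ℝ) + 1) / x)) := by
    intro i
    push_cast
    field_simp
    ring
  simp only [h, Finset.prod_mul_distrib, Finset.prod_const, Finset.card_univ, Fintype.card_fin]
  push_cast
  ring

theorem rising_factorial_strict_ineq (n : ℕ) (hn : 1 < n) (x : ℝ) (hx : x ∈ Set.Icc (0:ℝ) 1)
    (r : ℕ) (hr : (r : ℝ) ≤ n * x - Real.sqrt n)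
    (c : ℝ) (hc₁ : -(min x (1 - x)) / (n - 1) ≤ c) (hc₂ : c < 0) :
    risingFac x c (r + 1) * risingFac (1 - x) c (n - r) / risingFac 1 c n <
      x ^ (r + 1) * (1 - x) ^ (n - r) := by
  have hn1 : (1 : ℝ) < n := by exact_mod_cast hn
  have hsqrt : 1 ≤ Real.sqrt n := Real.one_le_sqrt.mpr hn1.le
  have hrn : r < n := by
    have : (r : ℝ) < n := by nlinarith [hx.2]
    exact_mod_cast this
  rw [div_le_iff₀ (by linarith)] at hc₁
  have hcx : -c * ((n : ℝ) - 1) ≤ x := by linarith [min_le_left x (1 - x)]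
  have hcy : -c * ((n : ℝ) - 1) ≤ 1 - x := by linarith [min_le_right x (1 - x)]
  have hd : 0 < -c := by linarith
  have hdn : 0 < -c * ((n : ℝ) - 1) := mul_pos hd (by linarith)
  have hx0 : 0 < x := by linarith
  have hy0 : 0 < 1 - x := by linarith
  obtain ⟨m, rfl⟩ : ∃ m, n = r + m + 1 := ⟨n - r - 1, by omega⟩
  have hsub : r + m + 1 - r = m + 1 := by omega
  push_cast at hcx hcy hr
  have hr1 : (r : ℝ) + 1 ≤ (r + m + 1) * x := by push_cast at hsqrt; linarith
  have hpoint : ∀ (N : ℕ) (y : ℝ), 0 < y → N ≤ r + m → -c * ((r : ℝ) + m + 1 - 1) ≤ y →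
      ∀ i : Fin N, -c * (((i : ℝ) + 1) / y) ≤ 1 := by
    intro N y hy hN hcy i
    have hi : ((i : ℕ) : ℝ) + 1 ≤ r + m := by
      have : (i : ℕ) + 1 ≤ r + m := by omega
      exact_mod_cast this
    rw [← mul_div_assoc, div_le_one hy]
    nlinarith
  have hbd : ∀ k : Fin (r + m), -c * ((k : ℝ) + 1) < 1 := by
    intro k
    have := hpoint (r + m) x hx0 le_rfl hcx k
    rw [← mul_div_assoc, div_le_one hx0] at this
    linarith
  have key : ∏ k : Fin (r + m), (1 - -c * Fin.append (fun i : Fin r => ((i : ℝ) + 1) / x)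
      (fun j : Fin m => ((j : ℝ) + 1) / (1 - x)) k) <
      ∏ k : Fin (r + m), (1 - -c * ((k : ℝ) + 1)) := by
    have hstrict := fun t => sum_max_sub_lt r m x t hx0 (by linarith) hr1
    apply prod_one_sub_lt_of_majorize _ _ _ hd
    · intro i j hij
      have : ((i : ℕ) : ℝ) ≤ (j : ℕ) := by exact_mod_cast hij
      simpa using this
    · intro k
      refine Fin.addCases (fun i => ?_) (fun j => ?_) k
      · rw [Fin.append_left]; positivity
      · rw [Fin.append_right]; positivity
    · intro k
      refine Fin.addCases (fun i => ?_) (fun j => ?_) k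
      · rw [Fin.append_left]; exact hpoint r x hx0 (by omega) hcx i
      · rw [Fin.append_right]; exact hpoint m (1 - x) hy0 (by omega) hcy j
    · intro k; positivity
    · exact hbd
    · intro t ht
      rcases le_total t (r + m) with h | h
      · rw [Fin.sum_univ_add (fun k => max (Fin.append _ _ k - t) 0)]
        simpa only [Fin.append_left, Fin.append_right] using (hstrict t ht h).le
      · rw [sum_max_sub_eq_zero (r + m) t (by push_cast; exact h)]
        exact Finset.sum_nonneg fun k _ => le_max_right _ _
    · have h0 := hstrict 0 le_rfl (by positivity)
      have hmax : ∀ z : ℝ, 0 ≤ z → max (z - 0) 0 = z := fun z hz => by simpa using hz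
      rw [Fin.sum_univ_add (Fin.append _ _)]
      simp only [Fin.append_left, Fin.append_right]
      convert h0 using 2
      · rw [hmax _ (by positivity)]
      · exact Finset.sum_congr rfl fun i _ => (hmax _ (by positivity)).symm
      · exact Finset.sum_congr rfl fun i _ => (hmax _ (by positivity)).symm
  rw [Fin.prod_univ_add] at key
  simp only [Fin.append_left, Fin.append_right] at key
  rw [hsub, risingFac_succ_eq x c hx0.ne', risingFac_succ_eq (1 - x) c hy0.ne',
    risingFac_succ_eq 1 c one_ne_zero]
  simp only [div_one, one_pow, one_mul]
  rw [div_lt_iff₀ (Finset.prod_pos fun k _ => by linarith [hbd k]), mul_mul_mul_comm]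
  exact mul_lt_mul_of_pos_left key (by positivity)
end

section
/- Let n > 1 be an integer, let x ∈ (0,1), and let c be a real number with -min{x,1-x}/(n-1) ≤ c < 0. Then x · (1-x)^{(n,c)} / 1^{(n,c)} < x · (1-x)^n. -/
open scoped BigOperators

/-- A product of nonnegative factors, each bounded by the corresponding positive factor and
strictly so at the last index, is strictly smaller. -/
lemma prod_range_succ_lt_of_le_of_last_lt {f g : ℕ → ℝ} {m : ℕ} (hf : ∀ i ≤ m, 0 ≤ f i)
    (hg : ∀ i ≤ m, 0 < g i) (hfg : ∀ i ≤ m, f i ≤ g i) (hlast : f m < g m) :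
    ∏ i ∈ Finset.range (m + 1), f i < ∏ i ∈ Finset.range (m + 1), g i := by
  rw [Finset.prod_range_succ, Finset.prod_range_succ]
  have hmem : ∀ i ∈ Finset.range m, i ≤ m := fun i hi => (Finset.mem_range.mp hi).le
  calc (∏ i ∈ Finset.range m, f i) * f m
      ≤ (∏ i ∈ Finset.range m, g i) * f m :=
        mul_le_mul_of_nonneg_right
          (Finset.prod_le_prod (fun i hi => hf i (hmem i hi)) fun i hi => hfg i (hmem i hi))
          (hf m le_rfl)
    _ < (∏ i ∈ Finset.range m, g i) * g m :=
        mul_lt_mul_of_pos_left hlast (Finset.prod_pos fun i hi => hg i (hmem i hi))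

theorem rising_factorial_ineq_r_zero (n : ℕ) (hn : 1 < n) (x : ℝ) (hx : x ∈ Set.Ioo (0:ℝ) 1)
    (c : ℝ) (hc₁ : -(min x (1 - x)) / (n - 1) ≤ c) (hc₂ : c < 0) :
    x * risingFac (1 - x) c n / risingFac 1 c n < x * (1 - x) ^ n := by
  obtain ⟨hx0, hx1⟩ := hx
  obtain ⟨m, rfl⟩ : ∃ m, n = m + 1 := ⟨n - 1, by omega⟩
  have hm : (0 : ℝ) < m := by exact_mod_cast (by omega : 0 < m)
  have hmc : -(1 - x) ≤ m * c := by
    rw [Nat.cast_add_one, add_sub_cancel_right, div_le_iff₀ hm] at hc₁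
    linarith [min_le_right x (1 - x)]
  have hnum : ∀ i ≤ m, 0 ≤ 1 - x + i * c := fun i hi => by
    have : (i : ℝ) ≤ m := by exact_mod_cast hi
    nlinarith
  have hden : ∀ i ≤ m, 0 < 1 + i * c := fun i hi => by linarith [hnum i hi]
  have hdiff (i : ℕ) : (1 - x) * (1 + i * c) - (1 - x + i * c) = x * (i * -c) := by ring
  have hlt : risingFac (1 - x) c (m + 1) < (1 - x) ^ (m + 1) * risingFac 1 c (m + 1) := by
    have hpow := Finset.prod_const (s := Finset.range (m + 1)) (1 - x)
    rw [Finset.card_range] at hpow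
    rw [risingFac, risingFac, ← hpow, ← Finset.prod_mul_distrib]
    refine prod_range_succ_lt_of_le_of_last_lt hnum
      (fun i hi => mul_pos (sub_pos.mpr hx1) (hden i hi)) (fun i _ => ?_) ?_
    · rw [← sub_nonneg, hdiff]
      exact mul_nonneg hx0.le (mul_nonneg i.cast_nonneg (neg_pos.mpr hc₂).le)
    · rw [← sub_pos, hdiff]
      exact mul_pos hx0 (mul_pos hm (neg_pos.mpr hc₂))
  have hpos : 0 < risingFac 1 c (m + 1) :=
    Finset.prod_pos fun i hi => hden i (Nat.lt_succ_iff.mp (Finset.mem_range.mp hi))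
  rw [mul_div_assoc]
  exact mul_lt_mul_of_pos_left ((div_lt_iff₀ hpos).mpr hlt) hx0
end

section
/- Let n > 1 be an integer and let c be a real number with -1/n < c < 0. Then Σ_{i=1}^{n-1} ln( 1/(1+ic) ) < n · ∫_{1/n}^{1} ln( (1/n) / (1/n + ct) ) dt. -/
open scoped BigOperators

/-- The left Riemann sum with unit steps of a continuous strictly increasing function is strictly
smaller than its integral. -/
theorem StrictMonoOn.sum_Ico_lt_integral {f : ℝ → ℝ} {a b : ℕ} (hab : a < b)
    (hf : StrictMonoOn f (Set.Icc (a : ℝ) b)) (hcont : ContinuousOn f (Set.Icc (a : ℝ) b)) :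
    ∑ i ∈ Finset.Ico a b, f i < ∫ x in (a : ℝ)..b, f x := by
  have hsub : ∀ k ∈ Set.Ico a b, Set.Icc (k : ℝ) ((k + 1 : ℕ) : ℝ) ⊆ Set.Icc (a : ℝ) b :=
    fun k hk => Set.Icc_subset_Icc (by exact_mod_cast hk.1)
      (by exact_mod_cast Nat.succ_le_of_lt hk.2)
  have hle : ∀ k : ℕ, (k : ℝ) ≤ ((k + 1 : ℕ) : ℝ) := fun k => by simp
  rw [← intervalIntegral.sum_integral_adjacent_intervals_Ico (a := fun k : ℕ => (k : ℝ)) hab.le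
    fun k hk => (hcont.mono (hsub k hk)).intervalIntegrable_of_Icc (hle k)]
  refine Finset.sum_lt_sum_of_nonempty (Finset.nonempty_Ico.2 hab) fun k hk => ?_
  have hk' : k ∈ Set.Ico a b := by simpa using hk
  have hleft : (k : ℝ) ∈ Set.Icc (k : ℝ) ((k + 1 : ℕ) : ℝ) := Set.left_mem_Icc.2 (hle k)
  have hright : ((k + 1 : ℕ) : ℝ) ∈ Set.Icc (k : ℝ) ((k + 1 : ℕ) : ℝ) :=
    Set.right_mem_Icc.2 (hle k)
  have hlt : (k : ℝ) < ((k + 1 : ℕ) : ℝ) := by simp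
  calc f k = ∫ _ in (k : ℝ)..((k + 1 : ℕ) : ℝ), f k := by simp
    _ < ∫ x in (k : ℝ)..((k + 1 : ℕ) : ℝ), f x :=
      intervalIntegral.integral_lt_integral_of_continuousOn_of_le_of_exists_lt hlt
        continuousOn_const (hcont.mono (hsub k hk'))
        (fun x hx => hf.monotoneOn (hsub k hk' hleft)
          (hsub k hk' (Set.Ioc_subset_Icc_self hx)) hx.1.le)
        ⟨_, hright, hf (hsub k hk' hleft) (hsub k hk' hright) hlt⟩

theorem sum_log_lt_integral (n : ℕ) (hn : 1 < n) (c : ℝ) (hc₁ : -1 / n < c) (hc₂ : c < 0) :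
    ∑ i ∈ Finset.Icc 1 (n - 1), Real.log (1 / (1 + i * c)) <
      n * ∫ t in (1 / (n:ℝ))..1, Real.log ((1 / n) / (1 / n + c * t)) := by
  have hn₀ : (0 : ℝ) < n := by exact_mod_cast zero_lt_one.trans hn
  have hnc : -1 < c * n := (div_lt_iff₀ hn₀).1 hc₁
  have hpos : ∀ x ∈ Set.Icc ((1 : ℕ) : ℝ) n, 0 < 1 + x * c := fun x hx => by
    nlinarith [hx.2]
  have hmono : StrictMonoOn (fun x : ℝ => Real.log (1 / (1 + x * c)))
      (Set.Icc ((1 : ℕ) : ℝ) n) := fun x hx y hy hxy =>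
    Real.log_lt_log (one_div_pos.2 (hpos x hx))
      (one_div_lt_one_div_of_lt (hpos y hy) (by nlinarith))
  have hcont : ContinuousOn (fun x : ℝ => Real.log (1 / (1 + x * c)))
      (Set.Icc ((1 : ℕ) : ℝ) n) :=
    ContinuousOn.log (continuousOn_const.div (by fun_prop) fun x hx => (hpos x hx).ne')
      fun x hx => (one_div_pos.2 (hpos x hx)).ne'
  have hintegrand : ∀ t : ℝ, Real.log ((1 / n) / (1 / n + c * t)) =
      Real.log (1 / (1 + (n * t) * c)) := fun t => by
    have h : 1 + (n * t) * c = n * (1 / n + c * t) := by field_simp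
    rw [h, div_div, one_div]
  have hset : Finset.Icc 1 (n - 1) = Finset.Ico 1 n := by
    ext i
    simp only [Finset.mem_Icc, Finset.mem_Ico]
    omega
  have hsubst := intervalIntegral.mul_integral_comp_mul_left (a := 1 / (n : ℝ)) (b := 1)
    (f := fun x : ℝ => Real.log (1 / (1 + x * c))) (c := (n : ℝ))
  simp only [hintegrand]
  rw [hset, hsubst, mul_one_div_cancel hn₀.ne', mul_one]
  simpa only [Nat.cast_one] using hmono.sum_Ico_lt_integral hn hcont
end

section
/- Let n > 1 be an integer, let x ∈ (0,1), and let r be a real number with r ≤ nx - √n. Then n² ≤ 1 + r²/x + (n-r-1)²/(1-x). -/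
/-- The core inequality, with `s` playing the role of `√n`. -/
lemma two_mul_sq_sub_one_mul_le_sub_sq (s x : ℝ) (hx0 : 0 ≤ x) (hx1 : x ≤ 1) :
    2 * (s ^ 2 - 1) * (x * (1 - x)) ≤ (s - x) ^ 2 := by
  have hA : 0 < 1 - 2 * x + 2 * x ^ 2 := by nlinarith [sq_nonneg (2 * x - 1)]
  have hcube : 0 ≤ x * (1 - x) ^ 3 := mul_nonneg hx0 (pow_nonneg (sub_nonneg.2 hx1) 3)
  have hprod : 0 ≤ (1 - 2 * x + 2 * x ^ 2) *
      ((s - x) ^ 2 - 2 * (s ^ 2 - 1) * (x * (1 - x))) := by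
    have hsq := sq_nonneg (s * (1 - 2 * x + 2 * x ^ 2) - x)
    linear_combination hsq + 2 * hcube
  exact sub_nonneg.1 (nonneg_of_mul_nonneg_right hprod hA)

theorem quadratic_lower_bound (n : ℕ) (hn : 1 < n) (x : ℝ) (hx : x ∈ Set.Ioo (0:ℝ) 1)
    (r : ℝ) (hr : r ≤ n * x - Real.sqrt n) :
    (n : ℝ) ^ 2 ≤ 1 + r ^ 2 / x + ((n : ℝ) - r - 1) ^ 2 / (1 - x) := by
  obtain ⟨hx0, hx1⟩ := hx
  have hy : 0 < 1 - x := sub_pos.2 hx1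
  have hs : Real.sqrt n ^ 2 = n := Real.sq_sqrt n.cast_nonneg
  have hs1 : 1 ≤ Real.sqrt n := Real.one_le_sqrt.2 (by exact_mod_cast hn.le)
  have hcore := two_mul_sq_sub_one_mul_le_sub_sq (Real.sqrt n) x hx0.le hx1.le
  rw [hs] at hcore
  have hsq : (Real.sqrt n - x) ^ 2 ≤ (((n : ℝ) - 1) * x - r) ^ 2 :=
    pow_le_pow_left₀ (by linarith) (by linarith) 2
  have hid : 1 + r ^ 2 / x + ((n : ℝ) - r - 1) ^ 2 / (1 - x) =
      1 + ((n : ℝ) - 1) ^ 2 + (((n : ℝ) - 1) * x - r) ^ 2 / (x * (1 - x)) := by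
    field_simp
    ring
  have hdiv : 2 * ((n : ℝ) - 1) ≤ (((n : ℝ) - 1) * x - r) ^ 2 / (x * (1 - x)) :=
    (le_div_iff₀ (mul_pos hx0 hy)).2 (hcore.trans hsq)
  rw [hid]
  linear_combination hdiv
end

section
/- Let n > 1 be an integer, let x ∈ (0,1), let r be an integer with 0 < r < n-1 and r ≤ nx - √n, and let c be a real number with -min{x,1-x}/(n-1) < c < 0. Then ∫_0^1 ln(1/(1+cnt)) dt ≤ ∫_0^1 [ (1/n)·ln(1/(1+ct)) + (r/n)·ln(1/(1+crt/x)) + ((n-r-1)/n)·ln(1/(1+c(n-r-1)t/(1-x))) ] dt. -/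
/-- Three-point weighted Jensen inequality for the logarithm. -/
lemma weighted_log_le_log_weighted {u v w a b d : ℝ} (hu : 0 ≤ u) (hv : 0 ≤ v) (hw : 0 ≤ w)
    (huvw : u + v + w = 1) (ha : 0 < a) (hb : 0 < b) (hd : 0 < d) :
    u * Real.log a + v * Real.log b + w * Real.log d ≤ Real.log (u * a + v * b + w * d) := by
  have hconc := strictConcaveOn_log_Ioi.concaveOn.le_map_sum
    (t := Finset.univ) (w := ![u, v, w]) (p := ![a, b, d])
    (by intro i _; fin_cases i <;> simpa)
    (by simpa [Fin.sum_univ_three] using huvw)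
    (by intro i _; fin_cases i <;> simpa)
  simpa [Fin.sum_univ_three] using hconc

/-- The logarithm of the reciprocal reverses the three-point Jensen inequality. -/
lemma log_one_div_le_weighted {u v w a b d y : ℝ} (hu : 0 ≤ u) (hv : 0 ≤ v) (hw : 0 ≤ w)
    (huvw : u + v + w = 1) (ha : 0 < a) (hb : 0 < b) (hd : 0 < d)
    (hy : u * a + v * b + w * d ≤ y) (hpos : 0 < u * a + v * b + w * d) :
    Real.log (1 / y) ≤
      u * Real.log (1 / a) + v * Real.log (1 / b) + w * Real.log (1 / d) := by
  have hlog := weighted_log_le_log_weighted hu hv hw huvw ha hb hd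
  have hmono := Real.log_le_log hpos hy
  simp only [one_div, Real.log_inv]
  linarith

lemma two_mul_sub_one_mul_le_sq_sub {q x : ℝ} (hx₀ : 0 < x) (hx₁ : x < 1) :
    2 * (q ^ 2 - 1) * (x * (1 - x)) ≤ (q - x) ^ 2 := by
  have hA : 0 < 1 - 2 * x + 2 * x ^ 2 := by nlinarith [sq_nonneg (1 - 2 * x)]
  have hcube : 0 ≤ x * (1 - x) ^ 3 := by
    have : 0 < 1 - x := by linarith
    positivity
  have key : 0 ≤ (1 - 2 * x + 2 * x ^ 2) * ((q - x) ^ 2 - 2 * (q ^ 2 - 1) * (x * (1 - x))) := by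
    have : (1 - 2 * x + 2 * x ^ 2) * ((q - x) ^ 2 - 2 * (q ^ 2 - 1) * (x * (1 - x))) =
        ((1 - 2 * x + 2 * x ^ 2) * q - x) ^ 2 + 2 * (x * (1 - x) ^ 3) := by ring
    rw [this]
    positivity
  linarith [nonneg_of_mul_nonneg_right key hA]

/-- The second-moment bound behind the logarithmic inequality. -/
lemma sq_le_one_add_sq_div_add_sq_div {N r x : ℝ} (hN : 1 ≤ N) (hx₀ : 0 < x) (hx₁ : x < 1)
    (hr : r ≤ N * x - √N) :
    N ^ 2 ≤ 1 + r ^ 2 / x + (N - r - 1) ^ 2 / (1 - x) := by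
  have hx₂ : 0 < 1 - x := by linarith
  have hq : √N ^ 2 = N := Real.sq_sqrt (by linarith)
  have hq₁ : 1 ≤ √N := Real.one_le_sqrt.2 hN
  have hbound := two_mul_sub_one_mul_le_sq_sub (q := √N) hx₀ hx₁
  rw [hq] at hbound
  have hsq : (√N - x) ^ 2 ≤ (N * x - r - x) ^ 2 :=
    pow_le_pow_left₀ (by linarith) (by linarith) 2
  have hdecomp : 1 + r ^ 2 / x + (N - r - 1) ^ 2 / (1 - x) =
      1 + (N - 1) ^ 2 + (N * x - r - x) ^ 2 / (x * (1 - x)) := by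
    field_simp
    ring
  have hdiv : 2 * (N - 1) ≤ (N * x - r - x) ^ 2 / (x * (1 - x)) := by
    rw [le_div_iff₀ (by positivity)]
    linarith
  rw [hdecomp]
  linarith

lemma one_add_mul_pos_of_mem_Icc {d t : ℝ} (hd : -1 < d) (ht : t ∈ Set.Icc (0 : ℝ) 1) :
    0 < 1 + d * t := by
  nlinarith [ht.1, ht.2, mul_nonneg ht.1 (by linarith : 0 ≤ d + 1)]

lemma intervalIntegrable_log_one_div {g : ℝ → ℝ} (hg : Continuous g)
    (hpos : ∀ t ∈ Set.Icc (0 : ℝ) 1, 0 < g t) :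
    IntervalIntegrable (fun t => Real.log (1 / g t)) MeasureTheory.volume 0 1 := by
  apply ContinuousOn.intervalIntegrable
  rw [Set.uIcc_of_le zero_le_one]
  simp only [one_div, Real.log_inv]
  exact (hg.continuousOn.log fun t ht => (hpos t ht).ne').neg

theorem integral_jensen_ineq (n : ℕ) (hn : 1 < n) (x : ℝ) (hx : x ∈ Set.Ioo (0:ℝ) 1)
    (r : ℕ) (hr₀ : 0 < r) (hr₁ : r < n - 1) (hr₂ : (r : ℝ) ≤ n * x - Real.sqrt n)
    (c : ℝ) (hc₁ : -(min x (1 - x)) / (n - 1) < c) (hc₂ : c < 0) :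
    (∫ t in (0:ℝ)..1, Real.log (1 / (1 + c * n * t))) ≤
      ∫ t in (0:ℝ)..1,
        ((1 / n) * Real.log (1 / (1 + c * t)) +
          ((r : ℝ) / n) * Real.log (1 / (1 + c * r * t / x)) +
          (((n : ℝ) - r - 1) / n) * Real.log (1 / (1 + c * ((n : ℝ) - r - 1) * t / (1 - x)))) := by
  obtain ⟨hx₀, hx₁⟩ := hx
  have hx₂ : 0 < 1 - x := by linarith
  have hr : (1 : ℝ) ≤ r := by exact_mod_cast hr₀
  have hrn : (r : ℝ) + 2 ≤ n := by exact_mod_cast (by omega : r + 2 ≤ n)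
  generalize (n : ℝ) = N at *
  generalize (r : ℝ) = R at *
  have hN : 0 < N - 1 := by linarith
  have hm : 0 < N - R - 1 := by linarith
  rw [div_lt_iff₀ hN] at hc₁
  have hcx : -x < c * (N - 1) := by linarith [min_le_left x (1 - x)]
  have hcx' : -(1 - x) < c * (N - 1) := by linarith [min_le_right x (1 - x)]
  have hpos₁ : ∀ t ∈ Set.Icc (0 : ℝ) 1, 0 < 1 + c * t := fun t ht =>
    one_add_mul_pos_of_mem_Icc (by nlinarith) ht
  have hpos₂ : ∀ t ∈ Set.Icc (0 : ℝ) 1, 0 < 1 + c * R * t / x := fun t ht => by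
    have hd : -1 < c * R / x := by
      rw [lt_div_iff₀ hx₀]
      nlinarith
    have := one_add_mul_pos_of_mem_Icc hd ht
    rwa [div_mul_eq_mul_div] at this
  have hpos₃ : ∀ t ∈ Set.Icc (0 : ℝ) 1, 0 < 1 + c * (N - R - 1) * t / (1 - x) := fun t ht => by
    have hd : -1 < c * (N - R - 1) / (1 - x) := by
      rw [lt_div_iff₀ hx₂]
      nlinarith
    have := one_add_mul_pos_of_mem_Icc hd ht
    rwa [div_mul_eq_mul_div] at this
  have hpos₄ : ∀ t ∈ Set.Icc (0 : ℝ) 1, 0 < 1 + c * N * t := fun t ht =>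
    one_add_mul_pos_of_mem_Icc (by nlinarith) ht
  have hmoment := sq_le_one_add_sq_div_add_sq_div (by linarith) hx₀ hx₁ hr₂
  have hN₀ : 0 < N := by linarith
  refine intervalIntegral.integral_mono_on zero_le_one
    (intervalIntegrable_log_one_div (by fun_prop) hpos₄)
    ((((intervalIntegrable_log_one_div (by fun_prop) hpos₁).const_mul _).add
      ((intervalIntegrable_log_one_div (by fun_prop) hpos₂).const_mul _)).add
      ((intervalIntegrable_log_one_div (by fun_prop) hpos₃).const_mul _)) fun t ht => ?_
  have h₁ := hpos₁ t ht
  have h₂ := hpos₂ t ht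
  have h₃ := hpos₃ t ht
  refine log_one_div_le_weighted (by positivity) (by positivity) (by positivity)
    (by field_simp; ring) h₁ h₂ h₃ ?_ (by positivity)
  have hmean : 1 / N * (1 + c * t) + R / N * (1 + c * R * t / x) +
      (N - R - 1) / N * (1 + c * (N - R - 1) * t / (1 - x)) =
      1 + c * t / N * (1 + R ^ 2 / x + (N - R - 1) ^ 2 / (1 - x)) := by
    field_simp
    ring
  have hct : c * t / N ≤ 0 :=
    div_nonpos_of_nonpos_of_nonneg (mul_nonpos_of_nonpos_of_nonneg hc₂.le ht.1) hN₀.le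
  calc _ = _ := hmean
    _ ≤ 1 + c * t / N * N ^ 2 := by linarith [mul_le_mul_of_nonpos_left hmoment hct]
    _ = 1 + c * N * t := by field_simp
end

section
/- Let n > 1 be an integer, let x ∈ (1/√n, 1], let r = r(x) be the largest integer strictly smaller than nx - √n, and let c be a real number with -min{x,1-x}/(n-1) ≤ c ≤ 0. Then Σ_{k=0}^{r} (x - k/n) · p_{n,k}^{x,1-x,c} = binom(n-1,r) · x^{(r+1,c)} (1-x)^{(n-r,c)} / 1^{(n,c)}. -/
open scoped BigOperators

/-- The Pólya–Eggenberger probability `p_{n,k}^{a,b,c}`. -/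
noncomputable def polyaP (n k : ℕ) (a b c : ℝ) : ℝ :=
  (n.choose k : ℝ) * risingFac a c k * risingFac b c (n - k) / risingFac (a + b) c n

/-- The largest integer strictly smaller than `nx - √n`, as a natural number. -/
noncomputable def rOf (n : ℕ) (x : ℝ) : ℕ := (⌈(n : ℝ) * x - Real.sqrt n⌉ - 1).toNat

/-- The function `F_n^c`. -/
noncomputable def Fn (n : ℕ) (c x : ℝ) : ℝ :=
  if x ≤ 1 / Real.sqrt n then 0
  else ((n - 1).choose (rOf n x) : ℝ) * risingFac x c (rOf n x + 1) *
      risingFac (1 - x) c (n - rOf n x) / risingFac 1 c n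

/-- The Bernstein-type operator `R_n`. -/
noncomputable def Rop (n : ℕ) (f : ℝ → ℝ) (x : ℝ) : ℝ :=
  ∑ k ∈ Finset.range (n + 1),
    polyaP n k x (1 - x) (-(min x (1 - x)) / (n - 1)) * f (k / n)

/-- The modulus of continuity of `f : [0,1] → ℝ`. -/
noncomputable def modCont (f : ℝ → ℝ) (δ : ℝ) : ℝ :=
  sSup {y : ℝ | ∃ s ∈ Set.Icc (0:ℝ) 1, ∃ t ∈ Set.Icc (0:ℝ) 1, |s - t| ≤ δ ∧ y = |f s - f t|}

theorem risingFac_succ (x h : ℝ) (n : ℕ) :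
    risingFac x h (n + 1) = risingFac x h n * (x + n * h) := by
  simp [risingFac, Finset.prod_range_succ]

/-- Closed form of the truncated first central moment of the Pólya–Eggenberger distribution. -/
theorem sum_range_sub_mul_polyaP (m r : ℕ) (hr : r ≤ m) (x c : ℝ) :
    ∑ k ∈ Finset.range (r + 1), (x - k / (m + 1 : ℕ)) * polyaP (m + 1) k x (1 - x) c =
      (m.choose r : ℝ) * risingFac x c (r + 1) * risingFac (1 - x) c (m + 1 - r) /
        risingFac 1 c (m + 1) := by
  induction r with
  | zero => simp [polyaP, risingFac, mul_div_assoc]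
  | succ r ih =>
    obtain ⟨d, rfl⟩ : ∃ d, m = r + 1 + d := ⟨m - (r + 1), by omega⟩
    rw [Finset.sum_range_succ, ih (by omega)]
    have hsub : r + 1 + d + 1 - r = d + 1 + 1 := by omega
    have hsub' : r + 1 + d + 1 - (r + 1) = d + 1 := by omega
    have hadd : x + (1 - x) = 1 := by ring
    simp only [polyaP, hsub, hsub', hadd]
    rw [risingFac_succ x c (r + 1), risingFac_succ (1 - x) c (d + 1)]
    have hpascal : ((r + 1 + d + 1).choose (r + 1) : ℝ) =
        (r + 1 + d).choose r + (r + 1 + d).choose (r + 1) := by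
      exact_mod_cast Nat.choose_succ_succ (r + 1 + d) r
    have habsorb : ((r + 1 + d).choose (r + 1) : ℝ) * (r + 1) =
        (r + 1 + d).choose r * (d + 1) := by
      have h := Nat.choose_succ_right_eq (r + 1 + d) r
      rw [show r + 1 + d - r = d + 1 by omega] at h
      exact_mod_cast h
    have hmean : ((r + 1 : ℕ) : ℝ) / (r + 1 + d + 1 : ℕ) * (r + 1 + d + 1).choose (r + 1) =
        (r + 1 + d).choose r := by
      rw [hpascal]
      field_simp
      push_cast
      linear_combination habsorb
    push_cast at hmean ⊢
    linear_combination (risingFac x c (r + 1) * risingFac (1 - x) c (d + 1) /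
      risingFac 1 c (r + 1 + d + 1)) * (x * hpascal - hmean - c * habsorb)

theorem rOf_lt (n : ℕ) (hn : 0 < n) (x : ℝ) (hx : x ≤ 1) : rOf n x < n := by
  have hn' : (0 : ℝ) < n := by exact_mod_cast hn
  have hceil : ⌈(n : ℝ) * x - Real.sqrt n⌉ ≤ (n : ℤ) := by
    rw [Int.ceil_le]
    push_cast
    nlinarith [Real.sqrt_nonneg (n : ℝ)]
  unfold rOf
  omega

theorem sum_lower_tail_eq (n : ℕ) (hn : 1 < n) (x : ℝ)
    (hx : x ∈ Set.Ioc (1 / Real.sqrt n) 1)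
    (c : ℝ) (hc₁ : -(min x (1 - x)) / (n - 1) ≤ c) (hc₂ : c ≤ 0) :
    ∑ k ∈ Finset.range (rOf n x + 1), (x - k / n) * polyaP n k x (1 - x) c =
      ((n - 1).choose (rOf n x) : ℝ) * risingFac x c (rOf n x + 1) *
        risingFac (1 - x) c (n - rOf n x) / risingFac 1 c n := by
  obtain ⟨m, rfl⟩ : ∃ m, n = m + 1 := ⟨n - 1, by omega⟩
  have hr := rOf_lt (m + 1) (by omega) x hx.2
  exact sum_range_sub_mul_polyaP m _ (by omega) x c
end

section
/- Let n > 1 be an integer, let x ∈ [0,1], and let c be a real number with -min{x,1-x}/(n-1) ≤ c ≤ 0. Then Σ_{k ∈ {0,…,n} : k/n - x > n^{-1/2}} (k/n - x) · p_{n,k}^{x,1-x,c} = F_n^c(1-x). -/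
open scoped BigOperators

/-- Telescoping closed form for the lower partial sums of the first central moment. -/
theorem sum_range_sub_mul_choose_mul_risingFac (m r : ℕ) (hr : r ≤ m) (y c : ℝ) :
    ∑ j ∈ Finset.range (r + 1), (y - (j : ℝ) / ((m + 1 : ℕ) : ℝ)) *
        (((m + 1).choose j : ℝ) * risingFac y c j * risingFac (1 - y) c (m + 1 - j)) =
      (m.choose r : ℝ) * risingFac y c (r + 1) * risingFac (1 - y) c (m + 1 - r) := by
  induction r with
  | zero => simp [risingFac]
  | succ r ih =>
    rw [Finset.sum_range_succ, ih (by lia), risingFac_succ y c (r + 1)]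
    obtain ⟨d, rfl⟩ := Nat.exists_eq_add_of_le hr
    rw [show r + 1 + d + 1 - r = (d + 1) + 1 by lia, show r + 1 + d + 1 - (r + 1) = d + 1 by lia,
      risingFac_succ _ c (d + 1), Nat.choose_succ_succ (r + 1 + d) r]
    have hAB : ((r + 1 + d).choose (r + 1) : ℝ) * (r + 1) = (r + 1 + d).choose r * (d + 1) := by
      have h := Nat.choose_succ_right_eq (r + 1 + d) r
      rw [show r + 1 + d - r = d + 1 by lia] at h
      exact_mod_cast h
    push_cast
    generalize ((r + 1 + d).choose (r + 1) : ℝ) = B at *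
    generalize ((r + 1 + d).choose r : ℝ) = A at *
    have hpos : (r : ℝ) + 1 + d + 1 ≠ 0 := by positivity
    have hquot : ((r : ℝ) + 1) / (r + 1 + d + 1) * (A + B) = A := by
      field_simp
      linear_combination hAB
    linear_combination (risingFac y c (r + 1) * risingFac (1 - y) c (d + 1)) *
      (-hquot - c * hAB)

theorem natCast_lt_iff_le_rOf {n : ℕ} {y : ℝ} (hy : 0 < (n : ℝ) * y - Real.sqrt n) (j : ℕ) :
    (j : ℝ) < n * y - Real.sqrt n ↔ j ≤ rOf n y := by
  have hceil : 0 < ⌈(n : ℝ) * y - Real.sqrt n⌉ := Int.ceil_pos.mpr hy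
  have h : (j : ℤ) < ⌈(n : ℝ) * y - Real.sqrt n⌉ ↔ (j : ℝ) < n * y - Real.sqrt n := by
    rw [Int.lt_ceil, Int.cast_natCast]
  rw [← h, rOf]
  lia

open scoped Classical in
theorem sum_upper_tail_eq (n : ℕ) (hn : 1 < n) (x : ℝ) (hx : x ∈ Set.Icc (0:ℝ) 1)
    (c : ℝ) (hc₁ : -(min x (1 - x)) / (n - 1) ≤ c) (hc₂ : c ≤ 0) :
    ∑ k ∈ (Finset.range (n + 1)).filter (fun k : ℕ => (k : ℝ) / n - x > 1 / Real.sqrt n),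
        ((k : ℝ) / n - x) * polyaP n k x (1 - x) c = Fn n c (1 - x) := by
  have hn0 : (0 : ℝ) < n := by exact_mod_cast (by lia : 0 < n)
  have hsqrt : (n : ℝ) * (1 / Real.sqrt n) = Real.sqrt n := by
    rw [mul_one_div, Real.div_sqrt]
  rw [Fn]
  split_ifs with hy
  · rw [Finset.filter_false_of_mem, Finset.sum_empty]
    intro k hk
    have hk' : (k : ℝ) / n ≤ 1 := by
      rw [div_le_one hn0]
      exact_mod_cast Finset.mem_range_succ_iff.mp hk
    linarith
  · have hpos : 0 < (n : ℝ) * (1 - x) - Real.sqrt n := by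
      rw [sub_pos, ← hsqrt]
      exact mul_lt_mul_of_pos_left (not_le.mp hy) hn0
    have hr : rOf n (1 - x) < n := by
      have h := (natCast_lt_iff_le_rOf hpos _).mpr le_rfl
      have h₁ : (n : ℝ) * (1 - x) ≤ n := mul_le_of_le_one_right hn0.le (by linarith [hx.1])
      exact_mod_cast (by linarith [Real.sqrt_nonneg n] : (rOf n (1 - x) : ℝ) < n)
    have hmem : ∀ k ≤ n, ((k : ℝ) / n - x > 1 / Real.sqrt n ↔ n - k ≤ rOf n (1 - x)) := by
      intro k hk
      rw [← natCast_lt_iff_le_rOf hpos, Nat.cast_sub hk, gt_iff_lt, ← mul_lt_mul_iff_right₀ hn0,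
        hsqrt, mul_sub, mul_div_cancel₀ _ hn0.ne']
      constructor <;> intro h <;> linarith
    obtain ⟨m, rfl⟩ : ∃ m, n = m + 1 := ⟨n - 1, by lia⟩
    rw [Nat.add_sub_cancel, ← sum_range_sub_mul_choose_mul_risingFac m _ (by lia), Finset.sum_div]
    refine Finset.sum_nbij' (fun k => m + 1 - k) (fun j => m + 1 - j) ?_ ?_ ?_ ?_ ?_
    · intro k hk
      rw [Finset.mem_filter, Finset.mem_range_succ_iff] at hk
      exact Finset.mem_range_succ_iff.mpr ((hmem k hk.1).mp hk.2)
    · intro j hj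
      rw [Finset.mem_range_succ_iff] at hj
      rw [Finset.mem_filter, Finset.mem_range_succ_iff]
      exact ⟨by lia, (hmem _ (by lia)).mpr (by lia)⟩
    · intro k hk
      rw [Finset.mem_filter, Finset.mem_range_succ_iff] at hk
      lia
    · intro j hj
      rw [Finset.mem_range_succ_iff] at hj
      lia
    · intro k hk
      rw [Finset.mem_filter, Finset.mem_range_succ_iff] at hk
      rw [polyaP, Nat.choose_symm hk.1, Nat.sub_sub_self hk.1, Nat.cast_sub hk.1, sub_div,
        div_self hn0.ne', sub_sub_cancel, add_sub_cancel]
      ring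
end

section
/- Let f : [0,1] → ℝ be continuous, let n > 1 be an integer, and let x ∈ [0,1]. Then |R_n(f;x) - f(x)| ≤ ω(n^{-1/2}) · ( 1 + √n · (F_n^0(x) + F_n^0(1-x)) ), where F_n^0 : [0,1] → ℝ is defined by F_n^0(x) = 0 for x ∈ [0, 1/√n] and F_n^0(x) = binom(n-1,r) · x^{r+1}(1-x)^{n-r} for x ∈ (1/√n, 1], with r = r(x) the largest integer strictly smaller than nx - √n. -/
open scoped BigOperators

/-- The function `F_n^0` (the case `c = 0`, written with ordinary powers). -/
noncomputable def Fn0 (n : ℕ) (x : ℝ) : ℝ :=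
  if x ≤ 1 / Real.sqrt n then 0
  else ((n - 1).choose (rOf n x) : ℝ) * x ^ (rOf n x + 1) * (1 - x) ^ (n - rOf n x)

theorem risingFac_nonneg {x h : ℝ} {n : ℕ} (H : ∀ i < n, 0 ≤ x + i * h) :
    0 ≤ risingFac x h n :=
  Finset.prod_nonneg fun i hi => H i (Finset.mem_range.1 hi)

/-- The Vandermonde identity for rising factorials. -/
theorem sum_antidiagonal_choose_mul_risingFac (a b c : ℝ) (n : ℕ) :
    ∑ ij ∈ Finset.HasAntidiagonal.antidiagonal n,
      (n.choose ij.1 : ℝ) * (risingFac a c ij.1 * risingFac b c ij.2) =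
      risingFac (a + b) c n := by
  induction n with
  | zero => simp [risingFac]
  | succ n ih =>
    rw [Finset.sum_antidiagonal_choose_succ_mul (fun i j => risingFac a c i * risingFac b c j),
      risingFac_succ, ← ih, Finset.sum_mul, ← Finset.sum_add_distrib]
    refine Finset.sum_congr rfl fun ij hij => ?_
    have h : ij.1 + ij.2 = n := Finset.HasAntidiagonal.mem_antidiagonal.1 hij
    have hc : n.choose ij.2 = n.choose ij.1 := Nat.choose_symm_of_eq_add (by omega)
    have hr : (n : ℝ) = ij.1 + ij.2 := by exact_mod_cast h.symm
    rw [hc, risingFac_succ, risingFac_succ, hr]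
    ring

theorem sum_polyaP {n : ℕ} {a b c : ℝ} (h : risingFac (a + b) c n ≠ 0) :
    ∑ k ∈ Finset.range (n + 1), polyaP n k a b c = 1 := by
  simp only [polyaP]
  rw [← Finset.sum_div, div_eq_one_iff_eq h, ← sum_antidiagonal_choose_mul_risingFac,
    Finset.Nat.sum_antidiagonal_eq_sum_range_succ_mk]
  simp [mul_assoc]

theorem polyaP_symm {n k : ℕ} (hk : k ≤ n) (a b c : ℝ) :
    polyaP n (n - k) a b c = polyaP n k b a c := by
  rw [polyaP, polyaP, Nat.choose_symm hk, Nat.sub_sub_self hk, add_comm b a]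
  ring

/-- Closed form of the truncated first moment of the Pólya–Eggenberger weights. -/
theorem sum_range_choose_mul_risingFac_mul_sub (x c : ℝ) (r s : ℕ) :
    ∑ k ∈ Finset.range (r + 1), ((r + s + 1).choose k : ℝ) * risingFac x c k *
        risingFac (1 - x) c (r + s + 1 - k) * ((r + s + 1 : ℕ) * x - k) =
      (r + s + 1 : ℕ) * (((r + s).choose r : ℝ) * risingFac x c (r + 1) *
        risingFac (1 - x) c (s + 1)) := by
  induction r generalizing s with
  | zero => simp [risingFac]; ring
  | succ r ih =>
    have e : r + 1 + s = r + (s + 1) := by omega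
    rw [Finset.sum_range_succ, e, ih (s + 1),
      show r + (s + 1) + 1 - (r + 1) = s + 1 by omega, risingFac_succ x c (r + 1),
      risingFac_succ (1 - x) c (s + 1)]
    have h1 : (((r + (s + 1)) + 1 : ℕ) : ℝ) * ((r + (s + 1)).choose r : ℝ) =
        ((r + (s + 1) + 1).choose (r + 1) : ℝ) * (r + 1 : ℕ) := by
      exact_mod_cast Nat.add_one_mul_choose_eq (r + (s + 1)) r
    have h2 : ((r + (s + 1) + 1).choose (r + 1) : ℝ) =
        ((r + (s + 1)).choose r : ℝ) + ((r + (s + 1)).choose (r + 1) : ℝ) := by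
      exact_mod_cast Nat.choose_succ_succ (r + (s + 1)) r
    have h3 : ((r + (s + 1)).choose (r + 1) : ℝ) * (r + 1 : ℕ) =
        ((r + (s + 1)).choose r : ℝ) * (s + 1 : ℕ) := by
      have := Nat.choose_succ_right_eq (r + (s + 1)) r
      rw [show r + (s + 1) - r = s + 1 by omega] at this
      exact_mod_cast this
    generalize ((r + (s + 1)).choose r : ℝ) = A at *
    generalize ((r + (s + 1)).choose (r + 1) : ℝ) = B at *
    generalize ((r + (s + 1) + 1).choose (r + 1) : ℝ) = C at *
    generalize risingFac x c (r + 1) = X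
    generalize risingFac (1 - x) c (s + 1) = Y
    subst h2
    push_cast at *
    linear_combination X * Y * h1 - X * Y * (r + (s + 1) + 1) * c * h3

/-- For a nonpositive increment, the product of two rising factorials starting at `x` and `1 - x`
is dominated by the corresponding powers times a rising factorial starting at `1`. -/
theorem risingFac_mul_risingFac_le {x c : ℝ} (hx0 : 0 ≤ x) (hx1 : x ≤ 1) (hc : c ≤ 0)
    (N : ℕ) : ∀ a b : ℕ, a + b = N → 0 ≤ x + a * c → 0 ≤ 1 - x + b * c →
      risingFac x c (a + 1) * risingFac (1 - x) c (b + 1) ≤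
        x ^ (a + 1) * (1 - x) ^ (b + 1) * risingFac 1 c (N + 1) := by
  induction N with
  | zero =>
    intro a b h _ _
    obtain ⟨rfl, rfl⟩ : a = 0 ∧ b = 0 := by omega
    simp [risingFac]
  | succ N ih =>
    intro a b h ha hb
    have hy0 : 0 ≤ 1 - x := by linarith
    have hN : ((N + 1 : ℕ) : ℝ) = a + b := by exact_mod_cast h.symm
    have ha' : (0 : ℝ) ≤ a := a.cast_nonneg
    have hb' : (0 : ℝ) ≤ b := b.cast_nonneg
    have hR : 0 ≤ risingFac 1 c (N + 1) := risingFac_nonneg fun i hi => by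
      have : (i : ℝ) ≤ a + b := by rw [← hN]; exact_mod_cast hi.le
      nlinarith
    rw [risingFac_succ 1 c (N + 1), hN]
    by_cases hab : x * (a + b) ≤ a ∧ 1 ≤ a
    · obtain ⟨h1, h2⟩ := hab
      obtain ⟨a, rfl⟩ : ∃ a', a = a' + 1 := ⟨a - 1, by omega⟩
      have hle := ih a b (by omega) (by push_cast at ha; nlinarith) hb
      have hstep : x + (a + 1 : ℕ) * c ≤ x * (1 + ((a + 1 : ℕ) + b) * c) := by nlinarith
      rw [risingFac_succ x c (a + 1), pow_succ x (a + 1)]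
      calc _ = (risingFac x c (a + 1) * risingFac (1 - x) c (b + 1)) *
            (x + (a + 1 : ℕ) * c) := by ring
        _ ≤ (x ^ (a + 1) * (1 - x) ^ (b + 1) * risingFac 1 c (N + 1)) *
            (x * (1 + ((a + 1 : ℕ) + b) * c)) := mul_le_mul hle hstep ha (by positivity)
        _ = _ := by ring
    · have hbx : (1 - x) * (a + b) ≤ b ∧ 1 ≤ b := by
        by_cases h2 : 1 ≤ a
        · have h1 : (a : ℝ) < x * (a + b) := by
            by_contra h3
            exact hab ⟨not_lt.1 h3, h2⟩
          refine ⟨by linarith, ?_⟩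
          by_contra h3
          obtain rfl : b = 0 := by omega
          push_cast at h1
          nlinarith
        · obtain rfl : a = 0 := by omega
          exact ⟨by push_cast; nlinarith, by omega⟩
      obtain ⟨h1, h2⟩ := hbx
      obtain ⟨b, rfl⟩ : ∃ b', b = b' + 1 := ⟨b - 1, by omega⟩
      have hle := ih a b (by omega) ha (by push_cast at hb; nlinarith)
      have hstep : 1 - x + (b + 1 : ℕ) * c ≤ (1 - x) * (1 + (a + (b + 1 : ℕ)) * c) := by
        nlinarith
      rw [risingFac_succ (1 - x) c (b + 1), pow_succ (1 - x) (b + 1)]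
      calc _ = (risingFac x c (a + 1) * risingFac (1 - x) c (b + 1)) *
            (1 - x + (b + 1 : ℕ) * c) := by ring
        _ ≤ (x ^ (a + 1) * (1 - x) ^ (b + 1) * risingFac 1 c (N + 1)) *
            ((1 - x) * (1 + (a + (b + 1 : ℕ)) * c)) := mul_le_mul hle hstep hb (by positivity)
        _ = _ := by ring

/-- The lower tail of the first absolute central moment is at most `F_n^0`. -/
theorem sum_polyaP_lower_tail_le {n : ℕ} {x c : ℝ} (hx0 : 0 ≤ x) (hx1 : x ≤ 1)
    (hc : c ≤ 0) (hcx : ∀ i < n, 0 ≤ x + i * c) (hcy : ∀ i < n, 0 ≤ 1 - x + i * c)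
    (hpos : 0 < risingFac 1 c n) (hn : 0 < n) :
    ∑ k ∈ Finset.range (n + 1), polyaP n k x (1 - x) c *
      (if (k : ℝ) < n * x - Real.sqrt n then x - k / n else 0) ≤ Fn0 n x := by
  have hn' : (0 : ℝ) < n := by exact_mod_cast hn
  have hs : 0 < Real.sqrt n := Real.sqrt_pos.2 hn'
  have hss : Real.sqrt n * Real.sqrt n = n := Real.mul_self_sqrt hn'.le
  by_cases hx : x ≤ 1 / Real.sqrt n
  · rw [Fn0, if_pos hx]
    refine (Finset.sum_eq_zero fun k _ => ?_).le
    rw [le_div_iff₀ hs] at hx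
    have hk : (0 : ℝ) ≤ k := k.cast_nonneg
    rw [if_neg (by nlinarith), mul_zero]
  · rw [Fn0, if_neg hx]
    rw [not_le, div_lt_iff₀ hs] at hx
    have h0 : 0 < n * x - Real.sqrt n := by nlinarith
    have hceil : 0 < ⌈(n : ℝ) * x - Real.sqrt n⌉ := Int.ceil_pos.2 h0
    have hr : ((rOf n x : ℕ) : ℤ) = ⌈(n : ℝ) * x - Real.sqrt n⌉ - 1 :=
      Int.toNat_of_nonneg (by omega)
    have hrn : rOf n x + 1 ≤ n := by
      have : ⌈(n : ℝ) * x - Real.sqrt n⌉ ≤ n := Int.ceil_le.2 (by push_cast; nlinarith)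
      omega
    have hiff : ∀ k : ℕ, (k : ℝ) < n * x - Real.sqrt n ↔ k < rOf n x + 1 := fun k => by
      have : ((k : ℤ) < ⌈(n : ℝ) * x - Real.sqrt n⌉) ↔ _ := Int.lt_ceil
      rw [Int.cast_natCast] at this
      rw [← this]
      omega
    generalize rOf n x = r at *
    obtain ⟨s, rfl⟩ : ∃ s, n = r + s + 1 := ⟨n - (r + 1), by omega⟩
    have hdom := risingFac_mul_risingFac_le hx0 hx1 hc (r + s) r s rfl (hcx r (by omega))
      (hcy s (by omega))
    have hsum : ∑ k ∈ Finset.range (r + s + 1 + 1), polyaP (r + s + 1) k x (1 - x) c *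
        (if (k : ℝ) < (r + s + 1 : ℕ) * x - Real.sqrt (r + s + 1 : ℕ)
          then x - k / (r + s + 1 : ℕ) else 0) =
        ((r + s).choose r : ℝ) * (risingFac x c (r + 1) * risingFac (1 - x) c (s + 1)) /
          risingFac 1 c (r + s + 1) := by
      rw [← Finset.sum_subset (Finset.range_subset_range.2 (show r + 1 ≤ r + s + 1 + 1 by omega))]
      · have hmom := sum_range_choose_mul_risingFac_mul_sub x c r s
        rw [eq_div_iff hpos.ne', Finset.sum_mul]
        apply mul_left_cancel₀ hn'.ne'
        rw [← mul_assoc (((r + s).choose r : ℕ) : ℝ), ← hmom, Finset.mul_sum]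
        refine Finset.sum_congr rfl fun k hk => ?_
        rw [if_pos ((hiff k).2 (Finset.mem_range.1 hk)), polyaP, add_sub_cancel]
        field_simp
      · intro k _ hk
        rw [if_neg fun h => hk (Finset.mem_range.2 ((hiff k).1 h)), mul_zero]
    rw [hsum, div_le_iff₀ hpos, show r + s + 1 - r = s + 1 by omega, Nat.add_sub_cancel,
      mul_assoc, mul_assoc]
    rw [mul_assoc] at hdom
    exact mul_le_mul_of_nonneg_left hdom (Nat.cast_nonneg _)

theorem abs_sub_le_modCont {f : ℝ → ℝ} (hf : ContinuousOn f (Set.Icc (0 : ℝ) 1)) {δ s t : ℝ}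
    (hs : s ∈ Set.Icc (0 : ℝ) 1) (ht : t ∈ Set.Icc (0 : ℝ) 1) (h : |s - t| ≤ δ) :
    |f s - f t| ≤ modCont f δ := by
  refine le_csSup ?_ ⟨s, hs, t, ht, h, rfl⟩
  obtain ⟨C, hC⟩ := isCompact_Icc.exists_bound_of_continuousOn hf
  refine ⟨C + C, ?_⟩
  rintro _ ⟨u, hu, v, hv, -, rfl⟩
  exact (abs_sub _ _).trans (add_le_add (hC u hu) (hC v hv))

theorem abs_sub_le_nat_mul_modCont {f : ℝ → ℝ} (hf : ContinuousOn f (Set.Icc (0 : ℝ) 1))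
    {δ s t : ℝ} (hs : s ∈ Set.Icc (0 : ℝ) 1) (ht : t ∈ Set.Icc (0 : ℝ) 1) {m : ℕ}
    (hm : 0 < m) (h : |s - t| ≤ m * δ) : |f s - f t| ≤ m * modCont f δ := by
  have hm' : (0 : ℝ) < m := by exact_mod_cast hm
  let g : ℕ → ℝ := fun i => s + (i / m : ℝ) * (t - s)
  have hg : ∀ i ≤ m, g i ∈ Set.Icc (0 : ℝ) 1 := fun i hi =>
    (convex_Icc (0 : ℝ) 1).add_smul_sub_mem hs ht
      ⟨by positivity, (div_le_one hm').2 (by exact_mod_cast hi)⟩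
  have hstep : ∀ {i}, i < m → dist (f (g i)) (f (g (i + 1))) ≤ modCont f δ := fun {i} hi => by
    refine abs_sub_le_modCont hf (hg i hi.le) (hg (i + 1) hi) ?_
    have : g i - g (i + 1) = (s - t) / m := by simp only [g]; push_cast; field_simp; ring
    rw [this, abs_div, abs_of_pos hm', div_le_iff₀ hm', mul_comm]
    exact h
  have := dist_le_range_sum_of_dist_le (f := fun i => f (g i)) m hstep
  have h0 : g 0 = s := by simp [g]
  have h1 : g m = t := by simp [g, hm'.ne']
  simpa [h0, h1, Real.dist_eq] using this

theorem abs_sub_le_modCont_mul {f : ℝ → ℝ} (hf : ContinuousOn f (Set.Icc (0 : ℝ) 1))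
    {δ s t : ℝ} (hδ : 0 < δ) (hs : s ∈ Set.Icc (0 : ℝ) 1) (ht : t ∈ Set.Icc (0 : ℝ) 1) :
    |f s - f t| ≤ modCont f δ * (1 + |s - t| / δ) := by
  have hω : 0 ≤ modCont f δ :=
    (abs_nonneg _).trans (abs_sub_le_modCont hf hs hs (by simpa using hδ.le))
  have hq : 0 ≤ |s - t| / δ := by positivity
  have hfl := Nat.lt_floor_add_one (|s - t| / δ)
  have h := abs_sub_le_nat_mul_modCont hf hs ht (m := ⌊|s - t| / δ⌋₊ + 1) (Nat.succ_pos _)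
    (by rw [div_lt_iff₀ hδ] at hfl; push_cast; exact hfl.le)
  refine h.trans ?_
  rw [mul_comm]
  refine mul_le_mul_of_nonneg_left ?_ hω
  have := Nat.floor_le hq
  push_cast
  linarith

theorem Rn_estimate_via_Fn0 (f : ℝ → ℝ) (hf : ContinuousOn f (Set.Icc (0:ℝ) 1))
    (n : ℕ) (hn : 1 < n) (x : ℝ) (hx : x ∈ Set.Icc (0:ℝ) 1) :
    |Rop n f x - f x| ≤
      modCont f (1 / Real.sqrt n) * (1 + Real.sqrt n * (Fn0 n x + Fn0 n (1 - x))) := by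
  obtain ⟨hx0, hx1⟩ := hx
  have hn0 : 0 < n := by omega
  have hn' : (0 : ℝ) < n := by exact_mod_cast hn0
  have hn1 : (0 : ℝ) < n - 1 := by
    have : (1 : ℝ) < n := by exact_mod_cast hn
    linarith
  have hsq : 0 < Real.sqrt n := Real.sqrt_pos.2 hn'
  have hss : Real.sqrt n * Real.sqrt n = n := Real.mul_self_sqrt hn'.le
  have hδ : 0 < 1 / Real.sqrt n := by positivity
  have hmin : 0 ≤ min x (1 - x) := le_min hx0 (by linarith)
  rw [Rop]
  set c : ℝ := -(min x (1 - x)) / (n - 1) with hcdef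
  have hc : c ≤ 0 := div_nonpos_of_nonpos_of_nonneg (by linarith) hn1.le
  have hic : ∀ i < n, -min x (1 - x) ≤ i * c := fun i hi => by
    have hi' : (i : ℝ) ≤ n - 1 := by
      have : (i : ℝ) + 1 ≤ n := by exact_mod_cast hi
      linarith
    have : (n - 1) * c = -min x (1 - x) := by rw [hcdef]; field_simp
    nlinarith
  have hcx : ∀ i < n, 0 ≤ x + i * c := fun i hi => by
    linarith [hic i hi, min_le_left x (1 - x)]
  have hcy : ∀ i < n, 0 ≤ 1 - x + i * c := fun i hi => by
    linarith [hic i hi, min_le_right x (1 - x)]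
  have hpos : 0 < risingFac 1 c n := Finset.prod_pos fun i hi => by
    have := hic i (Finset.mem_range.1 hi)
    linarith [min_le_left x (1 - x), min_le_right x (1 - x)]
  have hxy : x + (1 - x) = 1 := by ring
  have hsum : ∑ k ∈ Finset.range (n + 1), polyaP n k x (1 - x) c = 1 :=
    sum_polyaP (by rw [hxy]; exact hpos.ne')
  have hp : ∀ k ∈ Finset.range (n + 1), 0 ≤ polyaP n k x (1 - x) c := fun k hk => by
    have hk' : k ≤ n := Nat.lt_succ_iff.1 (Finset.mem_range.1 hk)
    rw [polyaP, hxy]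
    have h1 : 0 ≤ risingFac x c k := risingFac_nonneg fun i hi => hcx i (by omega)
    have h2 : 0 ≤ risingFac (1 - x) c (n - k) := risingFac_nonneg fun i hi => hcy i (by omega)
    positivity
  set ω := modCont f (1 / Real.sqrt n) with hωdef
  have hω : 0 ≤ ω := (abs_nonneg _).trans
    (abs_sub_le_modCont hf ⟨hx0, hx1⟩ ⟨hx0, hx1⟩ (by simp))
  let lo : ℕ → ℝ := fun k => if (k : ℝ) < n * x - Real.sqrt n then x - k / n else 0
  let hi : ℕ → ℝ := fun k =>
    if (k : ℝ) < n * (1 - x) - Real.sqrt n then (1 - x) - k / n else 0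
  have hlo : ∑ k ∈ Finset.range (n + 1), polyaP n k x (1 - x) c * lo k ≤ Fn0 n x :=
    sum_polyaP_lower_tail_le hx0 hx1 hc hcx hcy hpos hn0
  have hhi : ∑ k ∈ Finset.range (n + 1), polyaP n k x (1 - x) c * hi (n - k) ≤
      Fn0 n (1 - x) := by
    have h := sum_polyaP_lower_tail_le (x := 1 - x) (by linarith) (by linarith) hc hcy
      (fun i hi => by rw [sub_sub_cancel]; exact hcx i hi) hpos hn0
    rw [sub_sub_cancel, ← Finset.sum_range_reflect] at h
    refine le_of_eq_of_le (Finset.sum_congr rfl fun k hk => ?_) h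
    have hk' : k ≤ n := Nat.lt_succ_iff.1 (Finset.mem_range.1 hk)
    rw [show n + 1 - 1 - k = n - k by omega, polyaP_symm hk']
  have hterm : ∀ k ∈ Finset.range (n + 1),
      |f (k / n) - f x| ≤ ω * (1 + Real.sqrt n * (lo k + hi (n - k))) := fun k hk => by
    have hk' : k ≤ n := Nat.lt_succ_iff.1 (Finset.mem_range.1 hk)
    have hkn : (k : ℝ) ≤ n := by exact_mod_cast hk'
    have hkI : (k / n : ℝ) ∈ Set.Icc (0 : ℝ) 1 := ⟨by positivity, (div_le_one hn').2 hkn⟩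
    have hq : (k : ℝ) / n * n = k := by field_simp
    have hcast : ((n - k : ℕ) : ℝ) = n - k := Nat.cast_sub hk'
    have hquot : ((n : ℝ) - k) / n = 1 - k / n := by field_simp
    have hbig := abs_sub_le_modCont_mul hf hδ hkI ⟨hx0, hx1⟩
    rw [div_div_eq_mul_div, div_one, mul_comm |_|] at hbig
    simp only [lo, hi, hcast, hquot]
    generalize (k : ℝ) / n = q at *
    by_cases h1 : (k : ℝ) < n * x - Real.sqrt n
    · have hqx : q < x := by nlinarith
      rw [if_pos h1, if_neg (by nlinarith), add_zero]
      rwa [abs_of_neg (by linarith : q - x < 0), neg_sub] at hbig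
    · rw [if_neg h1]
      by_cases h2 : (n : ℝ) - k < n * (1 - x) - Real.sqrt n
      · have hqx : x < q := by nlinarith
        rw [if_pos h2]
        rw [abs_of_pos (by linarith : 0 < q - x)] at hbig
        convert hbig using 4
        ring
      · rw [if_neg h2, add_zero, mul_zero, add_zero, mul_one]
        refine abs_sub_le_modCont hf hkI ⟨hx0, hx1⟩ ?_
        have e : 1 / Real.sqrt n * n = Real.sqrt n := by
          rw [div_mul_eq_mul_div, one_mul, div_eq_iff hsq.ne', hss]
        rw [abs_le]
        constructor <;> nlinarith
  calc |∑ k ∈ Finset.range (n + 1), polyaP n k x (1 - x) c * f (k / n) - f x|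
      = |∑ k ∈ Finset.range (n + 1), polyaP n k x (1 - x) c * (f (k / n) - f x)| := by
        simp only [mul_sub, Finset.sum_sub_distrib]
        rw [← Finset.sum_mul, hsum, one_mul]
    _ ≤ ∑ k ∈ Finset.range (n + 1), |polyaP n k x (1 - x) c * (f (k / n) - f x)| :=
        Finset.abs_sum_le_sum_abs _ _
    _ ≤ ∑ k ∈ Finset.range (n + 1), polyaP n k x (1 - x) c *
          (ω * (1 + Real.sqrt n * (lo k + hi (n - k)))) :=
        Finset.sum_le_sum fun k hk => by
          rw [abs_mul, abs_of_nonneg (hp k hk)]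
          exact mul_le_mul_of_nonneg_left (hterm k hk) (hp k hk)
    _ = ω * (∑ k ∈ Finset.range (n + 1), polyaP n k x (1 - x) c + Real.sqrt n *
          (∑ k ∈ Finset.range (n + 1), polyaP n k x (1 - x) c * lo k +
            ∑ k ∈ Finset.range (n + 1), polyaP n k x (1 - x) c * hi (n - k))) := by
        simp only [Finset.mul_sum, ← Finset.sum_add_distrib]
        exact Finset.sum_congr rfl fun k _ => by ring
    _ ≤ ω * (1 + Real.sqrt n * (Fn0 n x + Fn0 n (1 - x))) := by
        rw [hsum]
        gcongr
end

section
/- For every x ∈ [0,1], one has F_6^{c(x)}(x) ≤ 0.014271, where c(x) = -min{x,1-x}/5. -/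
open scoped BigOperators

/-- The value of `risingFac 1 (-t / 5) 6`, with the factor `1 - t` singled out. -/
lemma risingFac_one_six (t : ℝ) : risingFac 1 (-t / 5) 6 =
    (1 - t) * ((1 - t / 5) * (1 - 2 * t / 5) * (1 - 3 * t / 5) * (1 - 4 * t / 5)) := by
  simp only [risingFac, Finset.prod_range_succ, Finset.prod_range_zero]; push_cast; ring

/-- The bound on the window where `rOf 6 x = 0` and `x ≤ 1 / 2`. -/
lemma F6_window_zero_le (x : ℝ) (h : 0.408 ≤ x) (h' : x ≤ 1 / 2) :
    ((6 - 1).choose 0 : ℝ) * risingFac x (-x / 5) (0 + 1) *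
      risingFac (1 - x) (-x / 5) (6 - 0) / risingFac 1 (-x / 5) 6 ≤ 0.014271 := by
  have ratio (j : ℝ) (hj : 1 ≤ j) : 1 - (5 + j) * (x / 5) ≤ 0.6 * (1 - j * (x / 5)) := by
    nlinarith
  have r1 := ratio 1 (by norm_num)
  have r2 := ratio 2 (by norm_num)
  have r3 := ratio 3 (by norm_num)
  have r4 := ratio 4 (by norm_num)
  have p1 : 0 < 1 - 1 * (x / 5) := by linarith
  have p2 : 0 < 1 - 2 * (x / 5) := by linarith
  have p3 : 0 < 1 - 3 * (x / 5) := by linarith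
  have p4 : 0 < 1 - 4 * (x / 5) := by linarith
  have p5 : 0 < 1 - x := by linarith
  have q1 : 0 ≤ 1 - (5 + 1) * (x / 5) := by linarith
  have q2 : 0 ≤ 1 - (5 + 2) * (x / 5) := by linarith
  have q3 : 0 ≤ 1 - (5 + 3) * (x / 5) := by linarith
  have q4 : 0 ≤ 1 - (5 + 4) * (x / 5) := by linarith
  have hlast : x * (1 - 2 * x) ≤ 0.08 := by nlinarith
  have hlast' : 0 ≤ x * (1 - 2 * x) := mul_nonneg (by linarith) (by linarith)
  have hD : risingFac 1 (-x / 5) 6 = (1 - x) * ((1 - 1 * (x / 5)) * (1 - 2 * (x / 5)) *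
      (1 - 3 * (x / 5)) * (1 - 4 * (x / 5))) := by
    rw [risingFac_one_six]; ring
  have hN : ((6 - 1).choose 0 : ℝ) * risingFac x (-x / 5) (0 + 1) *
      risingFac (1 - x) (-x / 5) (6 - 0) = (1 - x) * ((1 - (5 + 1) * (x / 5)) *
      (1 - (5 + 2) * (x / 5)) * (1 - (5 + 3) * (x / 5)) * (1 - (5 + 4) * (x / 5)) *
      (x * (1 - 2 * x))) := by
    simp only [risingFac, Finset.prod_range_succ, Finset.prod_range_zero, Nat.choose_zero_right]
    push_cast; ring
  rw [hN, hD, div_le_iff₀ (by positivity)]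
  calc _ ≤ (1 - x) * ((0.6 * (1 - 1 * (x / 5))) * (0.6 * (1 - 2 * (x / 5))) *
        (0.6 * (1 - 3 * (x / 5))) * (0.6 * (1 - 4 * (x / 5))) * 0.08) := by gcongr
    _ = 0.010368 * ((1 - x) * ((1 - 1 * (x / 5)) * (1 - 2 * (x / 5)) *
      (1 - 3 * (x / 5)) * (1 - 4 * (x / 5)))) := by ring
    _ ≤ _ := by gcongr; norm_num

/-- The bound on the window where `rOf 6 (1 - t) = 1`. -/
lemma F6_window_one_le (t : ℝ) (h : 0 ≤ t) (h' : t ≤ 0.426) :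
    ((6 - 1).choose 1 : ℝ) * risingFac (1 - t) (-t / 5) (1 + 1) *
      risingFac t (-t / 5) (6 - 1) / risingFac 1 (-t / 5) 6 ≤ 0.014271 := by
  have p1 : 0.91 ≤ 1 - t / 5 := by linarith
  have p2 : 0.82 ≤ 1 - 2 * t / 5 := by linarith
  have p3 : 0.74 ≤ 1 - 3 * t / 5 := by linarith
  have p4 : 0 < 1 - 4 * t / 5 := by linarith
  have p5 : 0 < 1 - t := by linarith
  have hN : ((6 - 1).choose 1 : ℝ) * risingFac (1 - t) (-t / 5) (1 + 1) *
      risingFac t (-t / 5) (6 - 1) = (1 - t) * (0.192 * t ^ 5 * (1 - 6 * t / 5)) := by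
    simp only [risingFac, Finset.prod_range_succ, Finset.prod_range_zero, Nat.choose_one_right]
    push_cast; ring
  rw [hN, risingFac_one_six, div_le_iff₀ (by positivity)]
  calc _ ≤ (1 - t) * (0.192 * 0.426 ^ 5 * (1 - 4 * t / 5)) := by
        gcongr <;> linarith
    _ ≤ (1 - t) * (0.014271 * (0.91 * 0.82 * 0.74) * (1 - 4 * t / 5)) := by
        gcongr (1 - t) * (?_ * _); norm_num
    _ = 0.014271 * ((1 - t) * (0.91 * 0.82 * 0.74 * (1 - 4 * t / 5))) := by ring
    _ ≤ _ := by gcongr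

/-- The bound on the window where `rOf 6 (1 - t) = 2`. -/
lemma F6_window_two_le (t : ℝ) (h : 0 ≤ t) (h' : t ≤ 0.259) :
    ((6 - 1).choose 2 : ℝ) * risingFac (1 - t) (-t / 5) (2 + 1) *
      risingFac t (-t / 5) (6 - 2) / risingFac 1 (-t / 5) 6 ≤ 0.014271 := by
  have p1 : 0.94 ≤ 1 - t / 5 := by linarith
  have p2 : 0.89 ≤ 1 - 2 * t / 5 := by linarith
  have p3 : 0 < 1 - 3 * t / 5 := by linarith
  have p4 : 0 < 1 - 4 * t / 5 := by linarith
  have p5 : 0 < 1 - t := by linarith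
  have q2 : 0 ≤ 1 - 7 * t / 5 := by linarith
  have hN : ((6 - 1).choose 2 : ℝ) * risingFac (1 - t) (-t / 5) (2 + 1) *
      risingFac t (-t / 5) (6 - 2) =
      (1 - t) * (1.92 * t ^ 4 * (1 - 6 * t / 5) * (1 - 7 * t / 5)) := by
    simp only [risingFac, Finset.prod_range_succ, Finset.prod_range_zero, Nat.choose]
    push_cast; ring
  rw [hN, risingFac_one_six, div_le_iff₀ (by positivity)]
  calc _ ≤ (1 - t) * (1.92 * 0.259 ^ 4 * (1 - 3 * t / 5) * (1 - 4 * t / 5)) := by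
        gcongr <;> linarith
    _ ≤ (1 - t) * (0.014271 * (0.94 * 0.89) * (1 - 3 * t / 5) * (1 - 4 * t / 5)) := by
        gcongr (1 - t) * (?_ * _ * _); norm_num
    _ = 0.014271 * ((1 - t) * (0.94 * 0.89 * (1 - 3 * t / 5) * (1 - 4 * t / 5))) := by ring
    _ ≤ _ := by gcongr

/-- The bound on the window where `rOf 6 (1 - t) = 3`. -/
lemma F6_window_three_le (t : ℝ) (h : 0 ≤ t) (h' : t ≤ 0.092) :
    ((6 - 1).choose 3 : ℝ) * risingFac (1 - t) (-t / 5) (3 + 1) *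
      risingFac t (-t / 5) (6 - 3) / risingFac 1 (-t / 5) 6 ≤ 0.014271 := by
  have p1 : 0.98 ≤ 1 - t / 5 := by linarith
  have p2 : 0 < 1 - 2 * t / 5 := by linarith
  have p3 : 0 < 1 - 3 * t / 5 := by linarith
  have p4 : 0 < 1 - 4 * t / 5 := by linarith
  have p5 : 0 < 1 - t := by linarith
  have q2 : 0 ≤ 1 - 7 * t / 5 := by linarith
  have q3 : 0 ≤ 1 - 8 * t / 5 := by linarith
  have hN : ((6 - 1).choose 3 : ℝ) * risingFac (1 - t) (-t / 5) (3 + 1) *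
      risingFac t (-t / 5) (6 - 3) =
      (1 - t) * (4.8 * t ^ 3 * (1 - 6 * t / 5) * (1 - 7 * t / 5) * (1 - 8 * t / 5)) := by
    simp only [risingFac, Finset.prod_range_succ, Finset.prod_range_zero, Nat.choose]
    push_cast; ring
  rw [hN, risingFac_one_six, div_le_iff₀ (by positivity)]
  calc _ ≤ (1 - t) * (4.8 * 0.092 ^ 3 * (1 - 2 * t / 5) * (1 - 3 * t / 5) * (1 - 4 * t / 5)) := by
        gcongr <;> linarith
    _ ≤ (1 - t) * (0.014271 * 0.98 * (1 - 2 * t / 5) * (1 - 3 * t / 5) * (1 - 4 * t / 5)) := by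
        gcongr (1 - t) * (?_ * _ * _ * _); norm_num
    _ = 0.014271 * ((1 - t) * (0.98 * (1 - 2 * t / 5) * (1 - 3 * t / 5) * (1 - 4 * t / 5))) := by
        ring
    _ ≤ _ := by gcongr

/-- The last factor of `t^{(6,-t/5)}` vanishes. -/
lemma risingFac_six_eq_zero (t : ℝ) : risingFac t (-t / 5) 6 = 0 := by
  simp only [risingFac, Finset.prod_range_succ]; push_cast; ring

theorem F6_le (x : ℝ) (hx : x ∈ Set.Icc (0:ℝ) 1) :
    Fn 6 (-(min x (1 - x)) / 5) x ≤ 0.014271 := by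
  obtain ⟨hx0, hx1⟩ := hx
  have hs1 : (2.449 : ℝ) < √6 := Real.lt_sqrt_of_sq_lt (by norm_num)
  have hs2 : √6 < (2.45 : ℝ) := (Real.sqrt_lt' (by norm_num)).2 (by norm_num)
  have hsq : √6 * √6 = (6 : ℝ) := Real.mul_self_sqrt (by norm_num)
  unfold Fn
  push_cast
  split_ifs with hle
  · norm_num
  rw [not_le, div_lt_iff₀ (by linarith)] at hle
  have hpos : 0 < 6 * x - √6 := by nlinarith
  obtain ⟨m, hm⟩ : ∃ m : ℤ, ⌈6 * x - √6⌉ = m := ⟨_, rfl⟩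
  have hr : rOf 6 x = (m - 1).toNat := by simp [rOf, hm]
  obtain ⟨hlow, hup⟩ := Int.ceil_eq_iff.1 hm
  have hm0 : 0 < m := by exact_mod_cast hpos.trans_le hup
  have hm4 : m < 5 := by
    have : (m : ℝ) < 5 := by linarith
    exact_mod_cast this
  rw [hr]
  have hmin (hhalf : 1 / 2 ≤ x) : min x (1 - x) = 1 - x := min_eq_right (by linarith)
  interval_cases m <;> norm_num only [Int.cast_ofNat, Int.cast_one] at hlow hup
  · rcases le_total x (1 / 2) with hhalf | hhalf
    · rw [min_eq_left (by linarith)]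
      exact F6_window_zero_le x (by linarith) hhalf
    · rw [hmin hhalf]
      change _ * risingFac (1 - x) (-(1 - x) / 5) 6 / _ ≤ _
      rw [risingFac_six_eq_zero]
      norm_num
  · rw [hmin (by linarith)]
    simpa only [sub_sub_cancel] using! F6_window_one_le (1 - x) (by linarith) (by linarith)
  · rw [hmin (by linarith)]
    simpa only [sub_sub_cancel] using! F6_window_two_le (1 - x) (by linarith) (by linarith)
  · rw [hmin (by linarith)]
    simpa only [sub_sub_cancel] using! F6_window_three_le (1 - x) (by linarith) (by linarith)
end

section
/- For every x ∈ [0,1], one has 1 + √6 · ( F_6^{c(x)}(x) + F_6^{c(x)}(1-x) ) ≤ 1 + 2√6 · 0.014271 < 1.0897, where c(x) = -min{x,1-x}/5 (note that c(x) = c(1-x)). -/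
open scoped BigOperators

lemma sqrt_six_bounds : (2.449 : ℝ) < Real.sqrt 6 ∧ Real.sqrt 6 < 2.45 :=
  ⟨(Real.lt_sqrt (by norm_num)).2 (by norm_num), (Real.sqrt_lt' (by norm_num)).2 (by norm_num)⟩

lemma one_div_sqrt_six : 1 / Real.sqrt 6 = Real.sqrt 6 / 6 := by
  have h : Real.sqrt 6 * Real.sqrt 6 = 6 := Real.mul_self_sqrt (by norm_num)
  have h0 : Real.sqrt 6 ≠ 0 := by positivity
  field_simp
  linarith

lemma rOf_eq {n k : ℕ} {y : ℝ} (h₁ : (k : ℝ) < n * y - Real.sqrt n)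
    (h₂ : n * y - Real.sqrt n ≤ k + 1) : rOf n y = k := by
  have h : ⌈(n : ℝ) * y - Real.sqrt n⌉ = (k : ℤ) + 1 := by
    rw [Int.ceil_eq_iff]
    push_cast
    exact ⟨by linarith, h₂⟩
  simp [rOf, h]

lemma Fn_six_eq {k : ℕ} {c y : ℝ} (h₁ : (k : ℝ) < 6 * y - Real.sqrt 6)
    (h₂ : 6 * y - Real.sqrt 6 ≤ k + 1) :
    Fn 6 c y = (Nat.choose 5 k : ℝ) * risingFac y c (k + 1) * risingFac (1 - y) c (6 - k) /
      risingFac 1 c 6 := by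
  have hr : rOf 6 y = k := rOf_eq (by exact_mod_cast h₁) (by exact_mod_cast h₂)
  have hy : ¬ y ≤ 1 / Real.sqrt ((6 : ℕ) : ℝ) := by
    have hk : (0 : ℝ) ≤ k := k.cast_nonneg
    rw [Nat.cast_ofNat, one_div_sqrt_six]
    linarith
  rw [Fn, if_neg hy, hr]

lemma risingFac_one_six_pos {m : ℝ} (h : m ≤ 1 / 2) : 0 < risingFac 1 (-m / 5) 6 := by
  refine Finset.prod_pos fun i hi => ?_
  have hi' : (i : ℝ) ≤ 5 := by exact_mod_cast Nat.lt_succ_iff.1 (Finset.mem_range.1 hi)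
  nlinarith [(i.cast_nonneg : (0 : ℝ) ≤ i)]

/-- The bound for `F_6` at the larger of the two points `m` and `1 - m`. -/
lemma Fn_six_one_sub_le {m : ℝ} (h0 : 0 ≤ m) (h : m ≤ 1 / 2) :
    Fn 6 (-m / 5) (1 - m) ≤ 0.014271 := by
  obtain ⟨hs₁, hs₂⟩ := sqrt_six_bounds
  have hD := risingFac_one_six_pos h
  have a1 : 0 ≤ 1 - 0.2 * m := by linarith
  have a2 : 0 ≤ 1 - 0.4 * m := by linarith
  have a3 : 0 ≤ 1 - 0.6 * m := by linarith
  have a4 : 0 ≤ 1 - 0.8 * m := by linarith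
  have a5 : 0 ≤ 1 - m := by linarith
  have b1 : 0 ≤ 1 - 1.2 * m := by linarith
  have b2 : 0 ≤ 1 - 1.4 * m := by linarith
  have b3 : 0 ≤ 1 - 1.6 * m := by linarith
  rcases le_or_gt (6 * (1 - m) - Real.sqrt 6) 1 with h1 | h1
  · rw [Fn_six_eq (k := 0) (by norm_num; linarith) (by norm_num; linarith)]
    have hz : risingFac (1 - (1 - m)) (-m / 5) (6 - 0) = 0 := by
      refine Finset.prod_eq_zero (i := 5) (by simp) ?_
      push_cast
      ring
    rw [hz]
    norm_num
  rcases le_or_gt (6 * (1 - m) - Real.sqrt 6) 2 with h2 | h2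
  · rw [Fn_six_eq (k := 1) (by norm_num; linarith) (by norm_num; linarith), div_le_iff₀ hD]
    have hm : m ≤ 0.426 := by linarith
    have e : 0.192 * m ^ 5 ≤ 0.014271 * ((1 - 0.4 * m) * (1 - 0.6 * m) * (1 - 0.8 * m)) := calc
      0.192 * m ^ 5 ≤ 0.192 * 0.426 ^ 5 := by gcongr
      _ ≤ 0.014271 * ((1 - 0.4 * 0.426) * (1 - 0.6 * 0.426) * (1 - 0.8 * 0.426)) := by norm_num
      _ ≤ _ := by gcongr
    calc _ = (1 - m) * ((1 - 1.2 * m) * (0.192 * m ^ 5)) := by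
          simp [risingFac, Finset.prod_range_succ, Nat.choose]; ring
      _ ≤ (1 - m) * ((1 - 0.2 * m) *
          (0.014271 * ((1 - 0.4 * m) * (1 - 0.6 * m) * (1 - 0.8 * m)))) := by
          gcongr; norm_num
      _ = _ := by simp [risingFac, Finset.prod_range_succ]; ring
  rcases le_or_gt (6 * (1 - m) - Real.sqrt 6) 3 with h3 | h3
  · rw [Fn_six_eq (k := 2) (by norm_num; linarith) (by norm_num; linarith), div_le_iff₀ hD]
    have hm : m ≤ 0.2585 := by linarith
    have e : 1.92 * m ^ 4 ≤ 0.014271 * ((1 - 0.6 * m) * (1 - 0.8 * m)) := calc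
      1.92 * m ^ 4 ≤ 1.92 * 0.2585 ^ 4 := by gcongr
      _ ≤ 0.014271 * ((1 - 0.6 * 0.2585) * (1 - 0.8 * 0.2585)) := by norm_num
      _ ≤ _ := by gcongr
    calc _ = (1 - m) * ((1 - 1.2 * m) * ((1 - 1.4 * m) * (1.92 * m ^ 4))) := by
          simp [risingFac, Finset.prod_range_succ, Nat.choose]; ring
      _ ≤ (1 - m) * ((1 - 0.2 * m) * ((1 - 0.4 * m) *
          (0.014271 * ((1 - 0.6 * m) * (1 - 0.8 * m))))) := by
          gcongr <;> norm_num
      _ = _ := by simp [risingFac, Finset.prod_range_succ]; ring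
  · rw [Fn_six_eq (k := 3) (by norm_num; linarith) (by norm_num; linarith), div_le_iff₀ hD]
    have hm : m ≤ 0.092 := by linarith
    have e : 4.8 * m ^ 3 ≤ 0.014271 * (1 - 0.8 * m) := calc
      4.8 * m ^ 3 ≤ 4.8 * 0.092 ^ 3 := by gcongr
      _ ≤ 0.014271 * (1 - 0.8 * 0.092) := by norm_num
      _ ≤ _ := by gcongr
    calc _ = (1 - m) * ((1 - 1.2 * m) * ((1 - 1.4 * m) * ((1 - 1.6 * m) * (4.8 * m ^ 3)))) := by
          simp [risingFac, Finset.prod_range_succ, Nat.choose]; ring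
      _ ≤ (1 - m) * ((1 - 0.2 * m) * ((1 - 0.4 * m) * ((1 - 0.6 * m) *
          (0.014271 * (1 - 0.8 * m))))) := by
          gcongr <;> norm_num
      _ = _ := by simp [risingFac, Finset.prod_range_succ]; ring

/-- The bound for `F_6` at the smaller of the two points `m` and `1 - m`. -/
lemma Fn_six_le {m : ℝ} (h : m ≤ 1 / 2) : Fn 6 (-m / 5) m ≤ 0.014271 := by
  obtain ⟨hs₁, hs₂⟩ := sqrt_six_bounds
  have hD := risingFac_one_six_pos h
  rcases le_or_gt m (Real.sqrt 6 / 6) with h1 | h1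
  · rw [Fn, if_pos (by rwa [Nat.cast_ofNat, one_div_sqrt_six])]
    norm_num
  rw [Fn_six_eq (k := 0) (by norm_num; linarith) (by norm_num; linarith), div_le_iff₀ hD]
  have hm : 0.408 < m := by linarith
  have b3 : 0 ≤ 1 - 1.6 * m := by linarith
  have b4 : 0 ≤ 1 - 1.8 * m := by linarith
  have b5 : 0 ≤ 1 - 2 * m := by linarith
  have c1 : 1 - 1.2 * m ≤ 0.56 * (1 - 0.2 * m) := by linarith
  have c2 : 1 - 1.4 * m ≤ 0.52 * (1 - 0.4 * m) := by linarith
  have c3 : 1 - 1.6 * m ≤ 0.6 * (1 - 0.6 * m) := by linarith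
  have c4 : 1 - 1.8 * m ≤ 0.5 * (1 - 0.8 * m) := by linarith
  have e : m * (1 - 2 * m) ≤ 0.1 := by nlinarith
  have a1 : 0 ≤ 1 - 0.2 * m := by linarith
  have a2 : 0 ≤ 1 - 0.4 * m := by linarith
  have a3 : 0 ≤ 1 - 0.6 * m := by linarith
  have a4 : 0 ≤ 1 - 0.8 * m := by linarith
  have a5 : 0 ≤ 1 - m := by linarith
  have b2 : 0 ≤ 1 - 1.4 * m := by linarith
  have hm0 : 0 ≤ m := by linarith
  calc _ = (1 - m) * ((1 - 1.2 * m) * ((1 - 1.4 * m) * ((1 - 1.6 * m) * ((1 - 1.8 * m) *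
        (m * (1 - 2 * m)))))) := by
        simp [risingFac, Finset.prod_range_succ]; ring
    _ ≤ (1 - m) * ((0.56 * (1 - 0.2 * m)) * ((0.52 * (1 - 0.4 * m)) * ((0.6 * (1 - 0.6 * m)) *
        ((0.5 * (1 - 0.8 * m)) * 0.1)))) := by
        gcongr
    _ = 0.008736 * ((1 - m) * (1 - 0.2 * m) * (1 - 0.4 * m) * (1 - 0.6 * m) * (1 - 0.8 * m)) := by
        ring
    _ ≤ 0.014271 * ((1 - m) * (1 - 0.2 * m) * (1 - 0.4 * m) * (1 - 0.6 * m) * (1 - 0.8 * m)) := by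
        gcongr; norm_num
    _ = _ := by simp only [risingFac, Finset.prod_range_succ, Finset.prod_range_zero]; push_cast; ring

theorem F6_sum_estimate (x : ℝ) (hx : x ∈ Set.Icc (0:ℝ) 1) :
    1 + Real.sqrt 6 * (Fn 6 (-(min x (1 - x)) / 5) x + Fn 6 (-(min x (1 - x)) / 5) (1 - x)) ≤
        1 + 2 * Real.sqrt 6 * 0.014271 ∧
      1 + 2 * Real.sqrt 6 * 0.014271 < (1.0897 : ℝ) := by
  obtain ⟨hx0, hx1⟩ := hx
  refine ⟨?_, by linarith [sqrt_six_bounds.2]⟩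
  have key : Fn 6 (-(min x (1 - x)) / 5) x + Fn 6 (-(min x (1 - x)) / 5) (1 - x) ≤
      2 * 0.014271 := by
    rcases le_total x (1 - x) with h | h
    · rw [min_eq_left h]
      linarith [Fn_six_le (m := x) (by linarith), Fn_six_one_sub_le hx0 (by linarith)]
    · rw [min_eq_right h]
      have h₁ := Fn_six_one_sub_le (m := 1 - x) (by linarith) (by linarith)
      rw [sub_sub_cancel] at h₁
      linarith [Fn_six_le (m := 1 - x) (by linarith)]
  linarith [mul_le_mul_of_nonneg_left key (Real.sqrt_nonneg 6)]
end

section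
/- For every x ∈ (1/√6, 1/2], one has x · (1-x)^{(6, -x/5)} / 1^{(6, -x/5)} < (193282 - 78887√6)/6804 (a number approximately equal to 0.00721673). -/
open scoped BigOperators

/-- For `2/5 ≤ x ≤ 1/2`, the quotient of the `i`-th factors of `(1-x)^{(6,-x/5)}` and
`1^{(6,-x/5)}` is at most its value at `x = 2/5`. -/
theorem factor_div_le {x t : ℝ} (hx : 2 / 5 ≤ x) (hx' : x ≤ 1 / 2) (ht : t ≤ 5) :
    (1 - x + t * (-x / 5)) / (1 + t * (-x / 5)) ≤ (15 - 2 * t) / (25 - 2 * t) := by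
  rw [div_le_div_iff₀ (by nlinarith) (by linarith)]
  nlinarith

/-- For `2/5 ≤ x ≤ 1/2`, the quotient of rising factorials is at most its value at `x = 2/5`. -/
theorem risingFac_div_le {x : ℝ} (hx : 2 / 5 ≤ x) (hx' : x ≤ 1 / 2) :
    risingFac (1 - x) (-x / 5) 6 / risingFac 1 (-x / 5) 6 ≤
      ∏ i ∈ Finset.range 6, (15 - 2 * (i : ℝ)) / (25 - 2 * (i : ℝ)) := by
  unfold risingFac
  rw [← Finset.prod_div_distrib]
  have hi : ∀ i ∈ Finset.range 6, (i : ℝ) ≤ 5 := fun i hi => by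
    exact_mod_cast Nat.le_of_lt_succ (Finset.mem_range.mp hi)
  refine Finset.prod_le_prod (fun i h => ?_) fun i h =>
    factor_div_le hx hx' (hi i h)
  have h5 := hi i h
  have h0 : (0 : ℝ) ≤ i := i.cast_nonneg
  exact div_nonneg (by nlinarith) (by nlinarith)

theorem F6_first_case_bound (x : ℝ) (hx : x ∈ Set.Ioc (1 / Real.sqrt 6) (1 / 2 : ℝ)) :
    x * risingFac (1 - x) (-x / 5) 6 / risingFac 1 (-x / 5) 6 <
      (193282 - 78887 * Real.sqrt 6) / 6804 := by
  obtain ⟨hlo, hhi⟩ := hx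
  have hsqrt : √6 < 2.4495 := by
    rw [Real.sqrt_lt' (by norm_num)]
    norm_num
  have hx : 2 / 5 ≤ x := by
    refine le_trans ?_ hlo.le
    rw [div_le_div_iff₀ (by norm_num) (by positivity)]
    linarith
  have hquot := risingFac_div_le hx hhi
  norm_num [Finset.prod_range_succ] at hquot
  rw [mul_div_assoc]
  nlinarith
end
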